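/- Let G be a group, ρ1, ρ2 : G → SL(2,ℝ) group homomorphisms, o1, o2 ∈ ℍ, and a, b ≥ 0. Assume: for every r ∈ ℝ the set {γ ∈ G : d1(γ) ≤ r} is finite; for all sufficiently large n ∈ ℕ the shell E_n := {γ ∈ G : n−1 < d1(γ) ≤ n} is nonempty; and there exists t ∈ ℝ for which γ ↦ exp(−(a·d1(γ) + b·d2(γ)) − t·d1(γ)) is summable over G. Let δ_PPS := inf{t ∈ ℝ : γ ↦ exp(−(a·d1(γ) + b·d2(γ)) − t·d1(γ)) is summable} and G₁(n) := ∑_{γ ∈ E_n} exp(−(a·d1(γ) + b·d2(γ))) (a finite sum). Then liminf_{n→∞} log(G₁(n))/n ≤ δ_PPS ≤ limsup_{n→∞} log(G₁(n))/n. -/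

import Mathlib

open scoped MatrixGroups UpperHalfPlane

/-- The orbital displacement `γ ↦ dist(o, ρ(γ)·o)` in the hyperbolic plane. -/
noncomputable def dOrb {G : Type*} [Group G] (ρ : G →* SL(2, ℝ)) (o : ℍ) (γ : G) : ℝ :=
  dist o (ρ γ • o)

abbrev M2 := Matrix (Fin 2) (Fin 2) ℝ

def frob (M : M2) : ℝ := M 0 0 ^ 2 + M 0 1 ^ 2 + M 1 0 ^ 2 + M 1 1 ^ 2

structure HRep {G : Type*} [Group G] (d : G → ℝ) (A : G →* M2) (P P' : M2) : Prop where
  hP : P' * P = 1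
  hP' : P * P' = 1
  det : ∀ g, (A g).det = 1
  nonneg : ∀ g, 0 ≤ d g
  mul : ∀ g h, d (g * h) ≤ d g + d h
  inv : ∀ g, d g⁻¹ = d g
  frob : ∀ g, 2 * Real.cosh (d g) = frob (P' * A g * P)

theorem frob_nonneg (M : M2) : 0 ≤ frob M := by unfold frob; positivity

theorem frob_mul_le (M N : M2) : frob (M * N) ≤ frob M * frob N := by
  unfold frob
  simp only [Matrix.mul_apply, Fin.sum_univ_two]
  have h : ∀ a b x y : ℝ, (a * x + b * y) ^ 2 ≤ (a ^ 2 + b ^ 2) * (x ^ 2 + y ^ 2) := by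
    intro a b x y
    nlinarith [sq_nonneg (a * y - b * x)]
  have h1 := h (M 0 0) (M 0 1) (N 0 0) (N 1 0)
  have h2 := h (M 0 0) (M 0 1) (N 0 1) (N 1 1)
  have h3 := h (M 1 0) (M 1 1) (N 0 0) (N 1 0)
  have h4 := h (M 1 0) (M 1 1) (N 0 1) (N 1 1)
  nlinarith

theorem frob_one : frob 1 = 2 := by
  simp [frob]; norm_num

theorem frob_smul (c : ℝ) (M : M2) : frob (c • M) = c ^ 2 * frob M := by
  simp [frob]; ring

theorem frob_pos_of_ne {M : M2} (h : M ≠ 0) : 0 < frob M := by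
  rcases (frob_nonneg M).lt_or_eq with h1 | h1
  · exact h1
  · exfalso
    apply h
    unfold frob at h1
    ext i j
    fin_cases i <;> fin_cases j <;> simp <;> nlinarith [sq_nonneg (M 0 0), sq_nonneg (M 0 1), sq_nonneg (M 1 0), sq_nonneg (M 1 1)]

theorem frob_pos_of_inv {M N : M2} (h : M * N = 1) : 0 < frob M := by
  apply frob_pos_of_ne
  rintro rfl
  have := congrFun (congrFun h 0) 0
  simp at this

theorem entry_sq_le_frob (M : M2) (i j : Fin 2) : (M i j) ^ 2 ≤ frob M := by
  unfold frob
  fin_cases i <;> fin_cases j <;> simp <;> nlinarith [sq_nonneg (M 0 0), sq_nonneg (M 0 1), sq_nonneg (M 1 0), sq_nonneg (M 1 1)]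

theorem frob_le_of_entry (M : M2) (R : ℝ) (h : ∀ i j, |M i j| ≤ R) : frob M ≤ 4 * R ^ 2 := by
  unfold frob
  have : ∀ i j, M i j ^ 2 ≤ R ^ 2 := fun i j => by
    rw [← sq_abs]; exact pow_le_pow_left₀ (abs_nonneg _) (h i j) 2
  linarith [this 0 0, this 0 1, this 1 0, this 1 1]

theorem continuous_frob : Continuous frob := by
  unfold frob; fun_prop

theorem frob_orb (g : SL(2, ℝ)) (o : ℍ) :
    2 * Real.cosh (dist o (g • o)) =
      frob ((!![o.im⁻¹, -o.re * o.im⁻¹; 0, 1] : M2) * (g : M2) * !![o.im, o.re; 0, 1]) := by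
  rw [UpperHalfPlane.cosh_dist, Complex.dist_eq, ← Complex.normSq_eq_norm_sq]
  have hy : 0 < o.im := o.im_pos
  have hw : 0 < (g • o).im := (g • o).im_pos
  have hdet := Matrix.det_fin_two (g : M2)
  rw [g.det_coe] at hdet
  have key := UpperHalfPlane.coe_specialLinearGroup_apply g o
  have hne : ((algebraMap ℝ ℝ) (g 1 0) : ℂ) * o + ((algebraMap ℝ ℝ) (g 1 1) : ℂ) ≠ 0 := by
    intro h
    rw [h, div_zero] at key
    have := congrArg Complex.im key
    simp at this
    exact hw.ne' this
  rw [eq_div_iff hne] at key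
  have k1 := congrArg Complex.re key
  have k2 := congrArg Complex.im key
  simp at k1 k2
  simp only [Complex.normSq_apply, Complex.sub_re, Complex.sub_im, UpperHalfPlane.coe_re, UpperHalfPlane.coe_im]
  generalize (g • o).im = wi at *
  generalize (g • o).re = wr at *
  generalize o.im = y at *
  generalize o.re = x at *
  simp only [frob, Matrix.mul_apply, Fin.sum_univ_two]
  simp
  generalize (g : M2) 0 0 = a at *
  generalize (g : M2) 0 1 = b at *
  generalize (g : M2) 1 0 = c at *
  generalize (g : M2) 1 1 = d at *
  have e1 : wi * ((c * x + d) ^ 2 + (c * y) ^ 2) = y := by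
    linear_combination (c * x + d) * k2 - c * y * k1 - y * hdet
  have e2 : wr * ((c * x + d) ^ 2 + (c * y) ^ 2) = (a * x + b) * (c * x + d) + a * c * y ^ 2 := by
    linear_combination (c * x + d) * k1 + c * y * k2
  have e3 : (wr ^ 2 + wi ^ 2) * ((c * x + d) ^ 2 + (c * y) ^ 2) = (a * x + b) ^ 2 + (a * y) ^ 2 := by
    linear_combination (wr * (c * x + d) - wi * (c * y) + a * x + b) * k1 + (wr * (c * y) + wi * (c * x + d) + a * y) * k2
  generalize hD : (c * x + d) ^ 2 + (c * y) ^ 2 = D at *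
  have hDpos : 0 < D := by
    by_contra h
    nlinarith
  have l : 2 * (1 + ((x - wr) * (x - wr) + (y - wi) * (y - wi)) / (2 * y * wi)) =
      ((x ^ 2 + y ^ 2) * D + ((a * x + b) ^ 2 + (a * y) ^ 2) - 2 * x * ((a * x + b) * (c * x + d) + a * c * y ^ 2)) / y ^ 2 := by
    rw [← e3, ← e2, ← e1]
    field_simp
    ring
  rw [l, ← hD]
  field_simp
  ring

theorem HRep.ofOrb {G : Type*} [Group G] (ρ : G →* SL(2, ℝ)) (o : ℍ) :
    ∃ A P P', HRep (dOrb ρ o) A P P' := by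
  have hy : o.im ≠ 0 := o.im_pos.ne'
  refine ⟨Matrix.SpecialLinearGroup.coeMonoidHom.comp ρ, !![o.im, o.re; 0, 1],
    !![o.im⁻¹, -o.re * o.im⁻¹; 0, 1], ?_, ?_, ?_, ?_, ?_, ?_, ?_⟩
  · ext i j
    fin_cases i <;> fin_cases j <;> simp [Matrix.mul_apply, Fin.sum_univ_two, hy] <;> field_simp <;> ring
  · ext i j
    fin_cases i <;> fin_cases j <;> simp [Matrix.mul_apply, Fin.sum_univ_two, hy] <;> field_simp <;> ring
  · intro g
    exact (ρ g).det_coe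
  · intro g
    exact dist_nonneg
  · intro g h
    unfold dOrb
    rw [map_mul, mul_smul]
    calc dist o (ρ g • ρ h • o) ≤ dist o (ρ g • o) + dist (ρ g • o) (ρ g • ρ h • o) := dist_triangle _ _ _
      _ = _ := by rw [dist_smul]
  · intro g
    unfold dOrb
    rw [map_inv, ← dist_smul (ρ g), smul_inv_smul, dist_comm]
  · intro g
    exact frob_orb (ρ g) o

namespace HRep

variable {G : Type*} [Group G] {d : G → ℝ} {A : G →* M2} {P P' : M2}

def conjHom (A : G →* M2) (R R' : M2) (h : R' * R = 1) (h' : R * R' = 1) : G →* M2 where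
  toFun g := R' * A g * R
  map_one' := by simp [h]
  map_mul' x y := by
    rw [map_mul]
    calc R' * (A x * A y) * R = R' * A x * 1 * A y * R := by simp [mul_assoc]
      _ = _ := by rw [← h']; simp only [mul_assoc]

theorem conj (H : HRep d A P P') (R R' : M2) (h : R' * R = 1) (h' : R * R' = 1) :
    HRep d (conjHom A R R' h h') (R' * P) (P' * R) where
  hP := by
    calc P' * R * (R' * P) = P' * (R * R') * P := by simp only [mul_assoc]
      _ = 1 := by rw [h', mul_one, H.hP]
  hP' := by
    calc R' * P * (P' * R) = R' * (P * P') * R := by simp only [mul_assoc]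
      _ = 1 := by rw [H.hP', mul_one, h]
  det g := by
    change (R' * A g * R).det = 1
    rw [Matrix.det_mul, Matrix.det_mul, H.det, mul_one, ← Matrix.det_mul, h, Matrix.det_one]
  nonneg := H.nonneg
  mul := H.mul
  inv := H.inv
  frob g := by
    change _ = _root_.frob (P' * R * (R' * A g * R) * (R' * P))
    rw [H.frob]
    congr 1
    calc P' * A g * P = P' * (1 * A g * 1) * P := by simp
      _ = _ := by rw [← h']; simp only [mul_assoc]

theorem d_one (H : HRep d A P P') : d 1 = 0 := by
  have h1 := H.frob 1
  rw [map_one, mul_one, H.hP, frob_one] at h1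
  have : Real.cosh (d 1) = 1 := by linarith
  by_contra hne
  have := Real.one_lt_cosh.2 hne
  linarith

theorem pow_le (H : HRep d A P P') (g : G) (n : ℕ) : d (g ^ n) ≤ n * d g := by
  induction n with
  | zero => simp [H.d_one]
  | succ k ih =>
    rw [pow_succ]
    have := H.mul (g ^ k) g
    push_cast
    linarith

theorem zpow_eq (H : HRep d A P P') (g : G) (n : ℤ) : d (g ^ n) = d (g ^ n.natAbs) := by
  rcases Int.natAbs_eq n with h | h
  · conv_lhs => rw [h]
    rw [zpow_natCast]
  · conv_lhs => rw [h]
    rw [zpow_neg, zpow_natCast, H.inv]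

theorem lower (H : HRep d A P P') : ∃ c : ℝ, 0 < c ∧ ∀ g, c * _root_.frob (A g) ≤ Real.exp (d g) := by
  have h1 := frob_pos_of_inv H.hP
  have h2 := frob_pos_of_inv H.hP'
  refine ⟨(2 * (_root_.frob P * _root_.frob P'))⁻¹, by positivity, fun g => ?_⟩
  have e : A g = P * (P' * A g * P) * P' := by
    calc A g = 1 * A g * 1 := by simp
      _ = _ := by rw [← H.hP']; simp only [mul_assoc]
  have l1 : _root_.frob (A g) ≤ _root_.frob P * (2 * Real.cosh (d g)) * _root_.frob P' := by
    rw [H.frob]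
    conv_lhs => rw [e]
    refine (frob_mul_le _ _).trans ?_
    gcongr
    exact frob_mul_le _ _
  have l2 : Real.cosh (d g) ≤ Real.exp (d g) := by
    rw [Real.cosh_eq]
    have : Real.exp (-d g) ≤ Real.exp (d g) := Real.exp_le_exp.2 (by linarith [H.nonneg g])
    linarith
  rw [inv_mul_le_iff₀ (by positivity)]
  calc _ ≤ _ := l1
    _ = 2 * (_root_.frob P * _root_.frob P') * Real.cosh (d g) := by ring
    _ ≤ _ := by gcongr

theorem upper (H : HRep d A P P') : ∃ c : ℝ, 0 < c ∧ ∀ g, Real.exp (d g) ≤ c * _root_.frob (A g) := by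
  have h1 := frob_pos_of_inv H.hP
  have h2 := frob_pos_of_inv H.hP'
  refine ⟨_root_.frob P' * _root_.frob P, by positivity, fun g => ?_⟩
  have l2 : Real.exp (d g) ≤ 2 * Real.cosh (d g) := by
    rw [Real.cosh_eq]
    have := Real.exp_pos (-d g)
    linarith
  refine l2.trans ?_
  rw [H.frob]
  refine (frob_mul_le _ _).trans ?_
  calc _ ≤ _root_.frob P' * _root_.frob (A g) * _root_.frob P := by
        gcongr
        exact frob_mul_le _ _
    _ = _ := by ring

theorem finite_entries (H : HRep d A P P') (hfin : ∀ r : ℝ, {γ : G | d γ ≤ r}.Finite) (R : ℝ) :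
    {γ : G | ∀ i j, |A γ i j| ≤ R}.Finite := by
  obtain ⟨c, hc, h⟩ := H.upper
  refine (hfin (c * (4 * R ^ 2))).subset fun γ hγ => ?_
  have := frob_le_of_entry _ R hγ
  have h2 := h γ
  have h3 := Real.add_one_le_exp (d γ)
  simp only [Set.mem_setOf_eq]
  have : c * _root_.frob (A γ) ≤ c * (4 * R ^ 2) := by gcongr
  linarith

end HRep

/-! Analytic part: the critical exponent equals the upper growth rate. -/

section Analytic

variable {G : Type*} (d W : G → ℝ)

noncomputable def shellSum (n : ℕ) : ℝ :=
  ∑' γ : {γ : G // (n : ℝ) - 1 < d γ ∧ d γ ≤ n}, Real.exp (-(W γ))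

theorem shell_finite (hfin : ∀ r : ℝ, {γ : G | d γ ≤ r}.Finite) (n : ℕ) :
    Finite {γ : G // (n : ℝ) - 1 < d γ ∧ d γ ≤ n} := by
  have : {γ : G | (n : ℝ) - 1 < d γ ∧ d γ ≤ n}.Finite := (hfin n).subset fun γ h => h.2
  exact this.to_subtype

theorem shellSum_nonneg (n : ℕ) : 0 ≤ shellSum d W n := tsum_nonneg fun _ => (Real.exp_pos _).le

theorem shellSum_ge (hfin : ∀ r : ℝ, {γ : G | d γ ≤ r}.Finite) (n : ℕ) (γ : G)
    (h : (n : ℝ) - 1 < d γ ∧ d γ ≤ n) : Real.exp (-(W γ)) ≤ shellSum d W n := by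
  have := shell_finite d hfin n
  have := Fintype.ofFinite {γ : G // (n : ℝ) - 1 < d γ ∧ d γ ≤ n}
  unfold shellSum
  have hsum : Summable fun γ : {γ : G // (n : ℝ) - 1 < d γ ∧ d γ ≤ n} => Real.exp (-(W γ)) :=
    Summable.of_finite
  exact hsum.le_tsum (⟨γ, h⟩ : {γ : G // (n : ℝ) - 1 < d γ ∧ d γ ≤ n})
    (fun j _ => (Real.exp_pos _).le)

theorem shellSum_le_of_summable (hfin : ∀ r : ℝ, {γ : G | d γ ≤ r}.Finite) (t : ℝ)
    (hs : Summable fun γ : G => Real.exp (-(W γ) - t * d γ)) (n : ℕ) :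
    shellSum d W n ≤ (∑' γ : G, Real.exp (-(W γ) - t * d γ)) * Real.exp |t| * Real.exp (t * n) := by
  have := shell_finite d hfin n
  have h1 : shellSum d W n ≤ ∑' γ : {γ : G // (n : ℝ) - 1 < d γ ∧ d γ ≤ n},
      Real.exp (-(W γ) - t * d γ) * (Real.exp |t| * Real.exp (t * n)) := by
    apply Summable.tsum_le_tsum _ Summable.of_finite Summable.of_finite
    rintro ⟨γ, h⟩
    rw [← Real.exp_add, ← Real.exp_add]
    apply Real.exp_le_exp.2
    simp only
    have : t * (d γ - n) ≤ |t| := by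
      refine (le_abs_self _).trans ?_
      rw [abs_mul]
      have : |d γ - n| ≤ 1 := by rw [abs_le]; constructor <;> linarith [h.1, h.2]
      nlinarith [abs_nonneg t]
    linarith
  rw [tsum_mul_right] at h1
  have h2 : ∑' γ : {γ : G // (n : ℝ) - 1 < d γ ∧ d γ ≤ n}, Real.exp (-(W γ) - t * d γ) ≤
      ∑' γ : G, Real.exp (-(W γ) - t * d γ) :=
    Summable.tsum_subtype_le (fun γ : G => Real.exp (-(W γ) - t * d γ))
      {γ : G | (n : ℝ) - 1 < d γ ∧ d γ ≤ n} (fun _ => (Real.exp_pos _).le) hs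
  rw [mul_assoc]
  exact h1.trans (by gcongr)

theorem eventually_le_of_summable (hfin : ∀ r : ℝ, {γ : G | d γ ≤ r}.Finite)
    (hshell : ∀ᶠ n : ℕ in Filter.atTop, ∃ γ : G, (n : ℝ) - 1 < d γ ∧ d γ ≤ n) (t s : ℝ) (hts : t < s)
    (hs : Summable fun γ : G => Real.exp (-(W γ) - t * d γ)) :
    ∀ᶠ n : ℕ in Filter.atTop, Real.log (shellSum d W n) / n ≤ s := by
  set C := (∑' γ : G, Real.exp (-(W γ) - t * d γ)) * Real.exp |t| with hC
  have hlim : Filter.Tendsto (fun n : ℕ => Real.log C / (n : ℝ)) Filter.atTop (nhds 0) :=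
    tendsto_const_div_atTop_nhds_zero_nat _
  filter_upwards [hshell, hlim.eventually (gt_mem_nhds (sub_pos.2 hts)), Filter.eventually_gt_atTop 0]
    with n ⟨γ, hγ⟩ h2 h3
  have hn : (0 : ℝ) < n := by exact_mod_cast h3
  have hpos : 0 < shellSum d W n := (Real.exp_pos _).trans_le (shellSum_ge d W hfin n γ hγ)
  have hle := shellSum_le_of_summable d W hfin t hs n
  rw [← hC] at hle
  have hCpos : 0 < C := by
    by_contra h
    have : C * Real.exp (t * n) ≤ 0 := mul_nonpos_of_nonpos_of_nonneg (not_lt.1 h) (Real.exp_pos _).le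
    linarith
  have hlog := Real.log_le_log hpos hle
  rw [Real.log_mul hCpos.ne' (Real.exp_pos _).ne', Real.log_exp] at hlog
  rw [div_le_iff₀ hn]
  rw [div_lt_iff₀ hn] at h2
  linarith

theorem summable_of_eventually_le (hd : ∀ γ, 0 ≤ d γ) (hfin : ∀ r : ℝ, {γ : G | d γ ≤ r}.Finite)
    (t s : ℝ) (hts : s < t)
    (hs : ∀ᶠ n : ℕ in Filter.atTop, Real.log (shellSum d W n) / n ≤ s) :
    Summable fun γ : G => Real.exp (-(W γ) - t * d γ) := by
  let σ : G → ℕ := fun γ => ⌈d γ⌉₊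
  have hσ : ∀ γ n, σ γ = n ↔ ((n : ℝ) - 1 < d γ ∧ d γ ≤ n) := by
    intro γ n
    rcases Nat.eq_zero_or_pos n with h | h
    · subst h
      simp only [σ, Nat.ceil_eq_zero]
      push_cast
      exact ⟨fun h => ⟨by linarith [hd γ], h⟩, fun h => h.2⟩
    · simp only [σ]
      rw [Nat.ceil_eq_iff h.ne', Nat.cast_pred h]
  rw [← (Equiv.sigmaFiberEquiv σ).summable_iff]
  have hfib : ∀ n, Finite {γ // σ γ = n} := by
    intro n
    have := shell_finite d hfin n
    exact Finite.of_equiv _ (Equiv.subtypeEquivRight (fun γ => (hσ γ n).symm))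
  have heq : ∀ n, ∑' γ : {γ // σ γ = n}, Real.exp (-(W γ)) = shellSum d W n := by
    intro n
    unfold shellSum
    exact (Equiv.subtypeEquivRight (fun γ => hσ γ n)).tsum_eq
      (fun γ : {γ : G // (n : ℝ) - 1 < d γ ∧ d γ ≤ n} => Real.exp (-(W γ)))
  change Summable fun x : (n : ℕ) × {γ // σ γ = n} => Real.exp (-(W x.2) - t * d x.2)
  rw [summable_sigma_of_nonneg (fun x => (Real.exp_pos _).le)]
  refine ⟨fun n => ?_, ?_⟩
  · have := hfib n
    exact Summable.of_finite
  · have hgeo : Summable fun n : ℕ => Real.exp |t| * Real.exp (s - t) ^ n := by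
      apply Summable.mul_left
      apply summable_geometric_of_lt_one (Real.exp_pos _).le
      rw [Real.exp_lt_one_iff]; linarith
    refine Summable.of_norm_bounded_eventually_nat hgeo ?_
    filter_upwards [hs, Filter.eventually_gt_atTop 0] with n h1 h2
    have hn : (0 : ℝ) < n := by exact_mod_cast h2
    have := hfib n
    rw [Real.norm_of_nonneg (tsum_nonneg fun _ => (Real.exp_pos _).le)]
    have hG : shellSum d W n ≤ Real.exp (s * n) := by
      rcases (shellSum_nonneg d W n).eq_or_lt with h | h
      · rw [← h]; exact (Real.exp_pos _).le
      · rw [div_le_iff₀ hn] at h1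
        exact (Real.log_le_iff_le_exp h).1 h1
    have hb : ∑' γ : {γ // σ γ = n}, Real.exp (-(W γ) - t * d γ) ≤
        ∑' γ : {γ // σ γ = n}, Real.exp (-(W γ)) * Real.exp (|t| - t * n) := by
      apply Summable.tsum_le_tsum _ Summable.of_finite Summable.of_finite
      rintro ⟨γ, h⟩
      rw [hσ] at h
      rw [← Real.exp_add]
      apply Real.exp_le_exp.2
      simp only
      have : t * (n - d γ) ≤ |t| := by
        refine (le_abs_self _).trans ?_
        rw [abs_mul]
        have : |n - d γ| ≤ 1 := by rw [abs_le]; constructor <;> linarith [h.1, h.2]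
        nlinarith [abs_nonneg t]
      linarith
    rw [tsum_mul_right, heq] at hb
    refine hb.trans ?_
    calc _ ≤ Real.exp (s * n) * Real.exp (|t| - t * n) := by gcongr
      _ = _ := by
        rw [← Real.exp_nat_mul, ← Real.exp_add, ← Real.exp_add]
        ring_nf

theorem sInf_eq_sInf {T S : Set ℝ} (hT : T.Nonempty) (h1 : ∀ t ∈ T, ∀ s, t < s → s ∈ S)
    (h2 : ∀ s ∈ S, ∀ t, s < t → t ∈ T) : sInf T = sInf S := by
  have aux : ∀ A B : Set ℝ, A.Nonempty → (∀ t ∈ A, ∀ s, t < s → s ∈ B) → BddBelow B →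
      sInf B ≤ sInf A := by
    intro A B hA h hB
    apply le_csInf hA
    intro t ht
    apply le_of_forall_pos_le_add
    intro ε hε
    exact csInf_le hB (h t ht _ (by linarith))
  have auxb : ∀ A B : Set ℝ, (∀ t ∈ A, ∀ s, t < s → s ∈ B) → BddBelow B → BddBelow A := by
    rintro A B h ⟨m, hm⟩
    refine ⟨m - 1, fun t ht => ?_⟩
    have := hm (h t ht (t + 1) (by linarith))
    linarith
  have hS : S.Nonempty := by
    obtain ⟨t, ht⟩ := hT
    exact ⟨t + 1, h1 t ht _ (by linarith)⟩
  by_cases hB : BddBelow T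
  · exact le_antisymm (aux S T hS h2 hB) (aux T S hT h1 (auxb S T h2 hB))
  · have hB' : ¬ BddBelow S := fun h => hB (auxb T S h1 h)
    rw [Real.sInf_of_not_bddBelow hB, Real.sInf_of_not_bddBelow hB']

theorem analytic_main (hd : ∀ γ, 0 ≤ d γ) (hfin : ∀ r : ℝ, {γ : G | d γ ≤ r}.Finite)
    (hshell : ∀ᶠ n : ℕ in Filter.atTop, ∃ γ : G, (n : ℝ) - 1 < d γ ∧ d γ ≤ n)
    (hconv : ∃ t : ℝ, Summable fun γ : G => Real.exp (-(W γ) - t * d γ))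
    (hkey : (∃ C : ℝ, ∀ᶠ n : ℕ in Filter.atTop,
        ∃ γ : G, ((n : ℝ) - 1 < d γ ∧ d γ ≤ n) ∧ W γ ≤ C * n) ∨
      ∀ t : ℝ, Summable fun γ : G => Real.exp (-(W γ) - t * d γ)) :
    Filter.liminf (fun n : ℕ => Real.log (shellSum d W n) / n) Filter.atTop ≤
      sInf {t : ℝ | Summable fun γ : G => Real.exp (-(W γ) - t * d γ)} ∧
    sInf {t : ℝ | Summable fun γ : G => Real.exp (-(W γ) - t * d γ)} ≤
      Filter.limsup (fun n : ℕ => Real.log (shellSum d W n) / n) Filter.atTop := by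
  have hS : sInf {t : ℝ | Summable fun γ : G => Real.exp (-(W γ) - t * d γ)} =
      Filter.limsup (fun n : ℕ => Real.log (shellSum d W n) / n) Filter.atTop := by
    rw [Filter.limsup_eq]
    exact sInf_eq_sInf hconv (fun t ht s hts => eventually_le_of_summable d W hfin hshell t s hts ht)
      (fun s hs t hts => summable_of_eventually_le d W hd hfin t s hts hs)
  refine ⟨?_, hS.le⟩
  rcases hkey with ⟨C, hC⟩ | hall
  · rw [hS]
    obtain ⟨t, ht⟩ := hconv
    have hup := eventually_le_of_summable d W hfin hshell t (t + 1) (by linarith) ht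
    have hlow : ∀ᶠ n : ℕ in Filter.atTop, -C ≤ Real.log (shellSum d W n) / n := by
      filter_upwards [hC, Filter.eventually_gt_atTop 0] with n ⟨γ, h1, h2⟩ h3
      have hn : (0 : ℝ) < n := by exact_mod_cast h3
      rw [le_div_iff₀ hn]
      have h4 := Real.log_le_log (Real.exp_pos _) (shellSum_ge d W hfin n γ h1)
      rw [Real.log_exp] at h4
      linarith
    exact Filter.liminf_le_limsup ⟨t + 1, Filter.eventually_map.2 hup⟩ ⟨-C, Filter.eventually_map.2 hlow⟩
  · have hu : {t : ℝ | Summable fun γ : G => Real.exp (-(W γ) - t * d γ)} = Set.univ :=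
      Set.eq_univ_of_forall hall
    rw [hu, Real.sInf_univ, Filter.liminf_eq]
    have he : {a : ℝ | ∀ᶠ n : ℕ in Filter.atTop, a ≤ Real.log (shellSum d W n) / n} = ∅ := by
      apply Set.eq_empty_of_forall_notMem
      intro a ha
      have hup := eventually_le_of_summable d W hfin hshell (a - 2) (a - 1) (by linarith) (hall _)
      obtain ⟨n, h1, h2⟩ := (hup.and (show ∀ᶠ n : ℕ in Filter.atTop, a ≤ Real.log (shellSum d W n) / n from ha)).exists
      linarith
    rw [he, Real.sSup_empty]

end Analytic

/-! Hyperbolic case. -/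

def LB {G : Type*} (d1 d2 : G → ℝ) : Prop :=
  ∃ C : ℝ, ∀ᶠ n : ℕ in Filter.atTop, ∃ γ : G, ((n : ℝ) - 1 < d1 γ ∧ d1 γ ≤ n) ∧ d2 γ ≤ C * n

theorem LB_of_linear {G : Type*} {d1 d2 : G → ℝ}
    (hshell : ∀ᶠ n : ℕ in Filter.atTop, ∃ γ : G, (n : ℝ) - 1 < d1 γ ∧ d1 γ ≤ n)
    (C1 C2 : ℝ) (h1 : 0 ≤ C1) (h2 : 0 ≤ C2) (h : ∀ γ, d2 γ ≤ C1 * d1 γ + C2) : LB d1 d2 := by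
  refine ⟨C1 + C2, ?_⟩
  filter_upwards [hshell, Filter.eventually_ge_atTop 1] with n ⟨γ, hγ⟩ hn
  refine ⟨γ, hγ, ?_⟩
  have hn' : (1 : ℝ) ≤ n := by exact_mod_cast hn
  have := h γ
  nlinarith [hγ.2]

namespace HRep

variable {G : Type*} [Group G] {d d2 : G → ℝ} {A B : G →* M2} {P P' Q Q' : M2}

theorem asymp (H : HRep d A P P') (w : ℕ → G) (c : ℕ → ℝ) (hc : Filter.Tendsto c Filter.atTop Filter.atTop)
    (L : M2) (hL : L ≠ 0) (hlim : Filter.Tendsto (fun n => (c n)⁻¹ • A (w n)) Filter.atTop (nhds L)) :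
    Filter.Tendsto (fun n => d (w n) - 2 * Real.log (c n)) Filter.atTop
      (nhds (Real.log (_root_.frob (P' * L * P)))) := by
  have hF : 0 < _root_.frob (P' * L * P) := by
    apply frob_pos_of_ne
    intro h0
    apply hL
    calc L = (P * P') * L * (P * P') := by rw [H.hP']; simp
      _ = P * (P' * L * P) * P' := by simp only [mul_assoc]
      _ = 0 := by rw [h0]; simp
  have t1 : Filter.Tendsto (fun n => _root_.frob (P' * ((c n)⁻¹ • A (w n)) * P)) Filter.atTop
      (nhds (_root_.frob (P' * L * P))) :=
    (continuous_frob.tendsto _).comp ((hlim.const_mul P').mul_const P)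
  have hX : ∀ᶠ n in Filter.atTop, 2 * Real.cosh (d (w n)) =
      (c n) ^ 2 * _root_.frob (P' * ((c n)⁻¹ • A (w n)) * P) := by
    filter_upwards [hc.eventually_gt_atTop 0] with n hn
    rw [H.frob, mul_smul_comm, smul_mul_assoc, frob_smul]
    field_simp
  have t2 : Filter.Tendsto (fun n => 2 * Real.cosh (d (w n))) Filter.atTop Filter.atTop := by
    have : Filter.Tendsto (fun n => (c n) ^ 2 * _root_.frob (P' * ((c n)⁻¹ • A (w n)) * P))
        Filter.atTop Filter.atTop :=
      Filter.Tendsto.atTop_mul_pos hF ((Filter.tendsto_pow_atTop (two_ne_zero)).comp hc) t1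
    exact this.congr' (hX.mono fun n h => h.symm)
  have t3 : Filter.Tendsto (fun n => Real.log (2 * Real.cosh (d (w n))) - d (w n)) Filter.atTop (nhds 0) := by
    have t4 : Filter.Tendsto (fun n => 2 * (2 * Real.cosh (d (w n)))⁻¹) Filter.atTop (nhds 0) := by
      simpa using (tendsto_inv_atTop_zero.comp t2).const_mul 2
    refine squeeze_zero (fun n => ?_) (fun n => ?_) t4
    · have : Real.exp (d (w n)) ≤ 2 * Real.cosh (d (w n)) := by
        rw [Real.cosh_eq]
        have := Real.exp_pos (-d (w n))
        linarith
      have := Real.log_le_log (Real.exp_pos _) this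
      rw [Real.log_exp] at this
      linarith
    · have hd := H.nonneg (w n)
      have e : 2 * Real.cosh (d (w n)) = Real.exp (d (w n)) * (1 + Real.exp (-2 * d (w n))) := by
        rw [Real.cosh_eq, mul_add, ← Real.exp_add]
        ring_nf
      have hle : Real.cosh (d (w n)) ≤ Real.exp (d (w n)) := by
        rw [Real.cosh_eq]
        have : Real.exp (-d (w n)) ≤ Real.exp (d (w n)) := Real.exp_le_exp.2 (by linarith)
        linarith
      have hc0 := Real.cosh_pos (d (w n))
      rw [e, Real.log_mul (Real.exp_pos _).ne' (by positivity), Real.log_exp, ← e]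
      have h1 : Real.log (1 + Real.exp (-2 * d (w n))) ≤ Real.exp (-2 * d (w n)) := by
        have := Real.log_le_sub_one_of_pos (show 0 < 1 + Real.exp (-2 * d (w n)) by positivity)
        linarith
      have h2 : Real.exp (-2 * d (w n)) ≤ (Real.exp (d (w n)))⁻¹ := by
        rw [← Real.exp_neg]
        exact Real.exp_le_exp.2 (by linarith)
      have h3 : (Real.exp (d (w n)))⁻¹ ≤ (Real.cosh (d (w n)))⁻¹ := by
        gcongr
      have h4 : 2 * (2 * Real.cosh (d (w n)))⁻¹ = (Real.cosh (d (w n)))⁻¹ := by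
        field_simp
      rw [h4]
      linarith
  have t5 := ((Real.continuousAt_log hF.ne').tendsto.comp t1).sub t3
  rw [sub_zero] at t5
  refine t5.congr' ?_
  filter_upwards [hX, hc.eventually_gt_atTop 0, t1.eventually (lt_mem_nhds hF)] with n h1 h2 h3
  simp only [Function.comp]
  rw [h1, Real.log_mul (by positivity) h3.ne', Real.log_pow]
  push_cast
  ring

theorem A_pow_diag {α : G} {l : ℝ} (hα : A α = !![l, 0; 0, l⁻¹]) (n : ℕ) :
    A (α ^ n) = !![l ^ n, 0; 0, (l⁻¹) ^ n] := by
  induction n with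
  | zero => simp [Matrix.one_fin_two]
  | succ k ih =>
    rw [pow_succ, map_mul, ih, hα]
    ext i j
    fin_cases i <;> fin_cases j <;> simp [Matrix.mul_apply, Fin.sum_univ_two, pow_succ]

theorem A_zpow_diag {α : G} {l : ℝ} (hl : l ≠ 0) (hα : A α = !![l, 0; 0, l⁻¹]) (n : ℤ) :
    A (α ^ n) = !![l ^ n, 0; 0, l ^ (-n)] := by
  rcases Int.natAbs_eq n with h | h
  · have e : A (α ^ n.natAbs) = !![l ^ n.natAbs, 0; 0, (l⁻¹) ^ n.natAbs] := A_pow_diag hα _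
    rw [h, zpow_natCast]
    set m := n.natAbs
    rw [e]
    simp
  · have e : A (α ^ n.natAbs) = !![l ^ n.natAbs, 0; 0, (l⁻¹) ^ n.natAbs] := A_pow_diag hα _
    rw [h, zpow_neg, zpow_natCast]
    set m := n.natAbs
    have e1 : A (α ^ m) * !![(l⁻¹) ^ m, 0; 0, l ^ m] = 1 := by
      rw [e]
      ext i j
      fin_cases i <;> fin_cases j <;> simp [Matrix.mul_apply, Fin.sum_univ_two, hl]
    calc A (α ^ m)⁻¹ = A (α ^ m)⁻¹ * (A (α ^ m) * !![(l⁻¹) ^ m, 0; 0, l ^ m]) := by rw [e1, mul_one]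
      _ = !![(l⁻¹) ^ m, 0; 0, l ^ m] := by rw [← mul_assoc, ← map_mul, inv_mul_cancel, map_one, one_mul]
      _ = _ := by simp

def E1 : M2 := !![1, 0; 0, 0]

theorem E1_mul_E1 : E1 * E1 = E1 := by
  ext i j
  fin_cases i <;> fin_cases j <;> simp [E1, Matrix.mul_apply, Fin.sum_univ_two]

theorem E1_mul_mul (X : M2) : E1 * (X * E1) = X 0 0 • E1 := by
  ext i j
  fin_cases i <;> fin_cases j <;> simp [E1, Matrix.mul_apply, Fin.sum_univ_two]

theorem E1_mul_pow (X : M2) (n : ℕ) : E1 * (X * E1) ^ n = (X 0 0) ^ n • E1 := by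
  induction n with
  | zero => simp
  | succ k ih =>
    rw [pow_succ, ← mul_assoc, ih, smul_mul_assoc, E1_mul_mul, smul_smul, pow_succ]

theorem E1_ne_zero : E1 ≠ 0 := by
  intro h
  have := congrFun (congrFun h 0) 0
  simp [E1] at this

theorem asymp_word (H : HRep d A P P') {α : G} {l : ℝ} (hl : 1 < l) (hα : A α = !![l, 0; 0, l⁻¹])
    (x x' : G) (hu : A x 0 0 ≠ 0) (hu' : A x' 0 0 ≠ 0) (i j k : ℕ) :
    Filter.Tendsto (fun n : ℕ => d (α ^ (n + i) * (x * α ^ n) ^ j * (x' * α ^ n) ^ k) -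
        (n * (j + k + 1) + i : ℕ) * (2 * Real.log l)) Filter.atTop
      (nhds (Real.log (_root_.frob (P' * E1 * P)) + j * Real.log ((A x 0 0) ^ 2) +
        k * Real.log ((A x' 0 0) ^ 2))) := by
  have hl0 : 0 < l := by linarith
  have tD : Filter.Tendsto (fun n : ℕ => (l ^ n)⁻¹ • A (α ^ n)) Filter.atTop (nhds E1) := by
    have e : ∀ n : ℕ, (l ^ n)⁻¹ • A (α ^ n) = !![1, 0; 0, ((l ^ 2)⁻¹) ^ n] := by
      intro n
      rw [A_pow_diag hα]
      ext i j
      fin_cases i <;> fin_cases j <;> simp [hl0.ne']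
      ring
    simp_rw [e]
    refine tendsto_pi_nhds.2 fun i => ?_
    refine tendsto_pi_nhds.2 fun j => ?_
    have hz : Filter.Tendsto (fun n : ℕ => ((l ^ 2)⁻¹) ^ n) Filter.atTop (nhds 0) :=
      tendsto_pow_atTop_nhds_zero_of_lt_one (by positivity) (inv_lt_one_of_one_lt₀ (by nlinarith))
    fin_cases i <;> fin_cases j <;> simp [E1]
    simpa using hz
  have hc : Filter.Tendsto (fun n : ℕ => l ^ (n * (j + k + 1) + i)) Filter.atTop Filter.atTop := by
    apply (tendsto_pow_atTop_atTop_of_one_lt hl).comp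
    apply Filter.tendsto_atTop_mono (fun n => ?_) Filter.tendsto_id
    simp only [id]
    nlinarith [Nat.zero_le (n * (j + k))]
  have hlim : Filter.Tendsto (fun n : ℕ => (l ^ (n * (j + k + 1) + i))⁻¹ •
      A (α ^ (n + i) * (x * α ^ n) ^ j * (x' * α ^ n) ^ k)) Filter.atTop
      (nhds (((A x 0 0) ^ j * (A x' 0 0) ^ k) • E1)) := by
    have t := (((tD.const_mul ((l ^ i)⁻¹ • A (α ^ i))).mul ((tD.const_mul (A x)).pow j)).mul
      ((tD.const_mul (A x')).pow k))
    have e1 : ((l ^ i)⁻¹ • A (α ^ i)) * E1 = E1 := by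
      rw [A_pow_diag hα]
      ext i j
      fin_cases i <;> fin_cases j <;> simp [E1, Matrix.mul_apply, Fin.sum_univ_two, hl0.ne']
    rw [e1, E1_mul_pow, smul_mul_assoc, E1_mul_pow, smul_smul] at t
    refine t.congr fun n => ?_
    simp only [map_mul, map_pow, pow_add, mul_smul_comm, smul_mul_assoc, smul_pow, smul_smul]
    rw [(Commute.pow_pow (Commute.refl (A α)) n i).eq]
    congr 1
    rw [pow_mul, pow_succ, pow_add]
    have hz : l ^ n ≠ 0 := by positivity
    generalize l ^ n = z at hz
    simp only [inv_pow]
    field_simp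
  have hne : ((A x 0 0) ^ j * (A x' 0 0) ^ k) • E1 ≠ 0 :=
    smul_ne_zero (mul_ne_zero (pow_ne_zero _ hu) (pow_ne_zero _ hu')) E1_ne_zero
  have := H.asymp _ _ hc _ hne hlim
  have hK : _root_.frob (P' * E1 * P) ≠ 0 := by
    apply ne_of_gt
    apply frob_pos_of_ne
    intro h0
    apply E1_ne_zero
    calc E1 = (P * P') * E1 * (P * P') := by rw [H.hP']; simp
      _ = P * (P' * E1 * P) * P' := by simp only [mul_assoc]
      _ = 0 := by rw [h0]; simp
  rw [mul_smul_comm, smul_mul_assoc, frob_smul, Real.log_mul (by positivity) hK, mul_pow,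
    Real.log_mul (by positivity) (by positivity), ← pow_mul, ← pow_mul, mul_comm j 2, mul_comm k 2,
    pow_mul _ 2 j, pow_mul _ 2 k, Real.log_pow (A x 0 0 ^ 2) j, Real.log_pow (A x' 0 0 ^ 2) k] at this
  convert this using 2
  · rw [Real.log_pow]; ring
  · ring

set_option maxHeartbeats 1000000 in
theorem cover (H : HRep d A P P') (H2 : HRep d2 B Q Q') {α : G} {l : ℝ} (hl : 1 < l)
    (hα : A α = !![l, 0; 0, l⁻¹])
    (x x' : G) (hu : A x 0 0 ≠ 0) (hu' : A x' 0 0 ≠ 0)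
    (h0 : 0 < Real.log ((A x 0 0) ^ 2) - Real.log ((A x' 0 0) ^ 2))
    (h1 : Real.log ((A x 0 0) ^ 2) - Real.log ((A x' 0 0) ^ 2) < 1) : LB d d2 := by
  set η := Real.log ((A x 0 0) ^ 2) - Real.log ((A x' 0 0) ^ 2) with hη
  set ℓ := 2 * Real.log l with hℓ
  have hℓ0 : 0 < ℓ := by have := Real.log_pos hl; positivity
  obtain ⟨M, hM⟩ := exists_nat_gt (ℓ / η)
  rw [div_lt_iff₀ h0] at hM
  set c0 := Real.log (_root_.frob (P' * E1 * P)) + M * Real.log ((A x' 0 0) ^ 2) with hc0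
  set ε := (1 - η) / 2 with hε
  have hε0 : 0 < ε := by rw [hε]; linarith
  have hev : ∀ᶠ n : ℕ in Filter.atTop, ∀ i ∈ Finset.range (M + 1), ∀ j ∈ Finset.range (M + 1),
      |d (α ^ (n + i) * (x * α ^ n) ^ j * (x' * α ^ n) ^ (M - j)) -
        (n * (M + 1) + i : ℕ) * ℓ - (c0 + j * η)| < ε := by
    rw [Filter.eventually_all_finset]
    intro i hi
    rw [Filter.eventually_all_finset]
    intro j hj
    have hjM : j ≤ M := by simpa [Nat.lt_succ_iff] using hj
    have := H.asymp_word hl hα x x' hu hu' i j (M - j)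
    rw [Nat.add_sub_cancel' hjM, Nat.cast_sub hjM] at this
    have e : Real.log (_root_.frob (P' * E1 * P)) + j * Real.log ((A x 0 0) ^ 2) +
        ((M : ℝ) - j) * Real.log ((A x' 0 0) ^ 2) = c0 + j * η := by
      rw [hc0, hη]; ring
    rw [e] at this
    exact (Metric.tendsto_nhds.1 this ε hε0)
  obtain ⟨n0, hn0⟩ := Filter.eventually_atTop.1 hev
  refine ⟨(1 + |c0|) / ℓ * d2 α + M * (d2 x + d2 x'), ?_⟩
  obtain ⟨N0, hN0⟩ := exists_nat_gt (ε + c0 + (n0 * (M + 1)) * ℓ)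
  filter_upwards [Filter.eventually_ge_atTop (max N0 1)] with N hN
  have hNN0 : (N0 : ℝ) ≤ N := by exact_mod_cast (le_max_left _ _).trans hN
  have hN1 : (1 : ℝ) ≤ N := by exact_mod_cast (le_max_right _ _).trans hN
  set k := ⌊(N - ε - c0) / ℓ⌋₊ with hk
  have hn0pos : (0 : ℝ) ≤ n0 * (M + 1) * ℓ := by positivity
  have hpos : 0 ≤ (N - ε - c0) / ℓ := by
    apply div_nonneg _ hℓ0.le
    linarith
  have hk1 : k * ℓ ≤ N - ε - c0 := by
    have := Nat.floor_le hpos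
    rwa [le_div_iff₀ hℓ0] at this
  have hk2 : N - ε - c0 < (k + 1) * ℓ := by
    have := Nat.lt_floor_add_one ((N - ε - c0) / ℓ)
    rwa [div_lt_iff₀ hℓ0] at this
  have hkn : n0 * (M + 1) ≤ k := by
    apply Nat.le_floor
    rw [le_div_iff₀ hℓ0]
    push_cast
    linarith
  set n := k / (M + 1) with hn
  set i := k % (M + 1) with hi
  have hni : n * (M + 1) + i = k := by
    rw [mul_comm]; exact Nat.div_add_mod k (M + 1)
  have hn_ge : n0 ≤ n := (Nat.le_div_iff_mul_le (Nat.succ_pos _)).2 hkn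
  have hi_lt : i < M + 1 := Nat.mod_lt _ (Nat.succ_pos _)
  set j := ⌊(N - ε - c0 - k * ℓ) / η⌋₊ with hj
  have hjpos : 0 ≤ (N - ε - c0 - k * ℓ) / η := div_nonneg (by linarith) h0.le
  have hj1 : j * η ≤ N - ε - c0 - k * ℓ := by
    have := Nat.floor_le hjpos
    rwa [le_div_iff₀ h0] at this
  have hj2 : N - ε - c0 - k * ℓ < (j + 1) * η := by
    have := Nat.lt_floor_add_one ((N - ε - c0 - k * ℓ) / η)
    rwa [div_lt_iff₀ h0] at this
  have hjM : j ≤ M := by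
    by_contra h
    push Not at h
    have : (M : ℝ) + 1 ≤ j := by exact_mod_cast h
    nlinarith
  have hb := hn0 n hn_ge i (Finset.mem_range.2 hi_lt) j (Finset.mem_range.2 (Nat.lt_succ_of_le hjM))
  rw [hni, abs_lt] at hb
  refine ⟨α ^ (n + i) * (x * α ^ n) ^ j * (x' * α ^ n) ^ (M - j), ⟨?_, ?_⟩, ?_⟩
  · linarith [hb.1]
  · linarith [hb.2]
  · have b1 := H2.mul (α ^ (n + i) * (x * α ^ n) ^ j) ((x' * α ^ n) ^ (M - j))
    have b2 := H2.mul (α ^ (n + i)) ((x * α ^ n) ^ j)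
    have b3 := H2.pow_le α (n + i)
    have b4 := H2.pow_le (x * α ^ n) j
    have b5 := H2.pow_le (x' * α ^ n) (M - j)
    have b6 := (H2.mul x (α ^ n))
    have b7 := (H2.mul x' (α ^ n))
    have b8 := H2.pow_le α n
    rw [Nat.cast_sub hjM] at b5
    have hjM' : (j : ℝ) ≤ M := by exact_mod_cast hjM
    have hj0 : (0 : ℝ) ≤ j := Nat.cast_nonneg _
    have c1 : (j : ℝ) * d2 (x * α ^ n) ≤ j * (d2 x + n * d2 α) := by gcongr; linarith
    have c2 : ((M : ℝ) - j) * d2 (x' * α ^ n) ≤ (M - j) * (d2 x' + n * d2 α) := by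
      apply mul_le_mul_of_nonneg_left (by linarith) (by linarith)
    have c3 : (j : ℝ) * d2 x ≤ M * d2 x := mul_le_mul_of_nonneg_right hjM' (H2.nonneg x)
    have c4 : ((M : ℝ) - j) * d2 x' ≤ M * d2 x' := mul_le_mul_of_nonneg_right (by linarith) (H2.nonneg x')
    have hk' : (k : ℝ) = n * (M + 1) + i := by rw [← hni]; push_cast; ring
    push_cast at b3
    have c5 : d2 (α ^ (n + i) * (x * α ^ n) ^ j * (x' * α ^ n) ^ (M - j)) ≤
        k * d2 α + M * (d2 x + d2 x') := by
      rw [hk']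
      nlinarith
    have c6 : (k : ℝ) ≤ (1 + |c0|) / ℓ * N := by
      rw [div_mul_eq_mul_div, le_div_iff₀ hℓ0]
      have := neg_abs_le c0
      nlinarith [abs_nonneg c0]
    have c7 : (k : ℝ) * d2 α ≤ (1 + |c0|) / ℓ * N * d2 α := mul_le_mul_of_nonneg_right c6 (H2.nonneg α)
    have c8 : M * (d2 x + d2 x') ≤ M * (d2 x + d2 x') * N := by
      have : 0 ≤ M * (d2 x + d2 x') := mul_nonneg (Nat.cast_nonneg _) (add_nonneg (H2.nonneg _) (H2.nonneg _))
      exact le_mul_of_one_le_right this hN1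
    calc _ ≤ _ := c5
      _ ≤ _ := by linarith

end HRep

namespace HRep

variable {G : Type*} [Group G] {d d2 : G → ℝ} {A B : G →* M2} {P P' Q Q' : M2}

theorem good_cover (H : HRep d A P P') (H2 : HRep d2 B Q Q') {α : G} {l : ℝ} (hl : 1 < l)
    (hα : A α = !![l, 0; 0, l⁻¹]) (y : G) (hp : A y 0 0 ≠ 0) (hq : A y 0 1 ≠ 0) (hr : A y 1 0 ≠ 0) :
    LB d d2 := by
  have hl0 : 0 < l := by linarith
  set p := A y 0 0
  set q := A y 0 1
  set r := A y 1 0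
  set v : ℕ → ℝ := fun n => p ^ 2 + q * r * ((l ^ 2)⁻¹) ^ n with hv
  have hx : ∀ n : ℕ, A (y * α ^ n * y) 0 0 = l ^ n * v n := by
    intro n
    rw [map_mul, map_mul, A_pow_diag hα]
    simp [Matrix.mul_apply, Fin.sum_univ_two, hv]
    field_simp
    simp only [p, q, r]
    ring
  have hx1 : ∀ n : ℕ, A (α * (y * α ^ n * y)) 0 0 = l ^ (n + 1) * v n := by
    intro n
    have := hx n
    have e : ∀ X : M2, (!![l, 0; 0, l⁻¹] * X) 0 0 = l * X 0 0 := by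
      intro X; simp [Matrix.mul_apply, Fin.sum_univ_two]
    rw [map_mul A α, hα, e, this]; ring
  have hz : Filter.Tendsto (fun n : ℕ => ((l ^ 2)⁻¹) ^ n) Filter.atTop (nhds 0) :=
    tendsto_pow_atTop_nhds_zero_of_lt_one (by positivity) (inv_lt_one_of_one_lt₀ (by nlinarith))
  have tv : Filter.Tendsto v Filter.atTop (nhds (p ^ 2)) := by
    have := (hz.const_mul (q * r)).const_add (p ^ 2)
    rw [mul_zero, add_zero] at this
    exact this
  have hp2 : 0 < p ^ 2 := by positivity
  have tlog : Filter.Tendsto (fun n => Real.log (v n ^ 2)) Filter.atTop (nhds (Real.log ((p ^ 2) ^ 2))) :=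
    (tv.pow 2).log (by positivity)
  have tdiff : Filter.Tendsto (fun n => Real.log (v n ^ 2) - Real.log (v (n + 1) ^ 2)) Filter.atTop (nhds 0) := by
    have := tlog.sub (tlog.comp (Filter.tendsto_add_atTop_nat 1))
    rw [sub_self] at this
    exact this
  have ev1 := tv.eventually (lt_mem_nhds hp2)
  have ev2 := (tv.comp (Filter.tendsto_add_atTop_nat 1)).eventually (lt_mem_nhds hp2)
  have ev3 := Metric.tendsto_nhds.1 tdiff 1 one_pos
  obtain ⟨n, h1, h2, h3⟩ := (ev1.and (ev2.and ev3)).exists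
  simp only [Function.comp] at h2
  rw [Real.dist_eq, sub_zero, abs_lt] at h3
  have hne : v n ≠ v (n + 1) := by
    intro h
    simp only [hv] at h
    have h4 : q * r * (((l ^ 2)⁻¹) ^ n * (1 - (l ^ 2)⁻¹)) = 0 := by
      rw [pow_succ] at h; linear_combination h
    have h5 : (l ^ 2)⁻¹ < 1 := inv_lt_one_of_one_lt₀ (by nlinarith)
    have h6 : 0 < ((l ^ 2)⁻¹) ^ n * (1 - (l ^ 2)⁻¹) := mul_pos (by positivity) (by linarith)
    rcases mul_eq_zero.1 h4 with h7 | h7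
    · exact mul_ne_zero hq hr h7
    · linarith
  have hu : A (α * (y * α ^ n * y)) 0 0 ≠ 0 := by rw [hx1]; positivity
  have hu' : A (y * α ^ (n + 1) * y) 0 0 ≠ 0 := by rw [hx]; positivity
  have e1 : Real.log ((A (α * (y * α ^ n * y)) 0 0) ^ 2) = Real.log ((l ^ (n + 1)) ^ 2) + Real.log (v n ^ 2) := by
    rw [hx1, mul_pow, Real.log_mul (by positivity) (by positivity)]
  have e2 : Real.log ((A (y * α ^ (n + 1) * y) 0 0) ^ 2) =
      Real.log ((l ^ (n + 1)) ^ 2) + Real.log (v (n + 1) ^ 2) := by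
    rw [hx, mul_pow, Real.log_mul (by positivity) (by positivity)]
  rcases lt_or_gt_of_ne hne with h | h
  · have : Real.log (v n ^ 2) < Real.log (v (n + 1) ^ 2) :=
      Real.log_lt_log (by positivity) (by gcongr)
    exact H.cover H2 hl hα _ _ hu' hu (by rw [e1, e2]; linarith) (by rw [e1, e2]; linarith [h3.1])
  · have : Real.log (v (n + 1) ^ 2) < Real.log (v n ^ 2) :=
      Real.log_lt_log (by positivity) (by gcongr)
    exact H.cover H2 hl hα _ _ hu hu' (by rw [e1, e2]; linarith) (by rw [e1, e2]; linarith [h3.2])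

theorem tri_aux (H : HRep d A P P') (hfin : ∀ r : ℝ, {γ : G | d γ ≤ r}.Finite) {α : G} {l : ℝ} (hl : 1 < l)
    (hα : A α = !![l, 0; 0, l⁻¹]) (y : G) : (A y 1 0 = 0 → A y 0 1 = 0) ∧ (A y 0 1 = 0 → A y 1 0 = 0) := by
  have hl0 : 0 < l := by linarith
  have hform : ∀ n : ℤ, A (α ^ (-n) * y * α ^ n) = !![A y 0 0, A y 0 1 * (l ^ 2) ^ (-n); A y 1 0 * (l ^ 2) ^ n, A y 1 1] := by
    intro n
    rw [map_mul, map_mul, A_zpow_diag hl0.ne' hα, A_zpow_diag hl0.ne' hα]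
    have h2 : ∀ m : ℤ, (l ^ 2) ^ m = l ^ m * l ^ m := by
      intro m; rw [pow_two, mul_zpow]
    have h3 : l ^ n ≠ 0 := (zpow_pos hl0 n).ne'
    generalize A y = Y
    rw [Matrix.eta_fin_two Y, Matrix.mul_fin_two, Matrix.mul_fin_two]
    ext i j
    fin_cases i <;> fin_cases j <;> simp [h2] <;> field_simp
  have hinj : ∀ c : ℝ, c ≠ 0 → ∀ f : ℕ → ℤ, Function.Injective f →
      (Function.Injective fun n : ℕ => c * (l ^ 2) ^ (f n)) := by
    intro c hc f hf m n h
    have h1 : (l ^ 2) ^ (f m) = (l ^ 2) ^ (f n) := mul_left_cancel₀ hc h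
    exact hf (zpow_right_injective₀ (by positivity) (by nlinarith) h1)
  have hle : ∀ n : ℕ, (l ^ 2) ^ (-(n : ℤ)) ≤ 1 := by
    intro n
    apply zpow_le_one_of_nonpos₀ (by nlinarith) (by simp)
  constructor
  · intro h0
    by_contra hne
    have hfinite := H.finite_entries hfin (|A y 0 0| + |A y 0 1| + |A y 1 1|)
    have hmaps : ∀ n : ℕ, (α ^ (-(n : ℤ)) * y * α ^ (n : ℤ)) ∈
        {γ : G | ∀ i j, |A γ i j| ≤ |A y 0 0| + |A y 0 1| + |A y 1 1|} := by
      intro n i j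
      rw [hform]
      have a1 := abs_nonneg (A y 0 0)
      have a2 := abs_nonneg (A y 0 1)
      have a3 := abs_nonneg (A y 1 1)
      have a4 : |A y 0 1 * (l ^ 2) ^ (-(n : ℤ))| ≤ |A y 0 1| := by
        rw [abs_mul, abs_of_pos (zpow_pos (show (0 : ℝ) < l ^ 2 by positivity) _)]
        exact mul_le_of_le_one_right a2 (hle n)
      fin_cases i <;> fin_cases j
      · change |A y 0 0| ≤ _; linarith
      · change |A y 0 1 * (l ^ 2) ^ (-(n : ℤ))| ≤ _; linarith
      · change |A y 1 0 * (l ^ 2) ^ (n : ℤ)| ≤ _; rw [h0, zero_mul, abs_zero]; linarith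
      · change |A y 1 1| ≤ _; linarith
    refine Set.infinite_of_injective_forall_mem (f := fun n : ℕ => α ^ (-(n : ℤ)) * y * α ^ (n : ℤ)) ?_ hmaps hfinite
    intro m n h
    have h1 : A (α ^ (-(m : ℤ)) * y * α ^ (m : ℤ)) 0 1 = A (α ^ (-(n : ℤ)) * y * α ^ (n : ℤ)) 0 1 :=
      congrArg (fun g => A g 0 1) h
    rw [hform, hform] at h1
    exact hinj (A y 0 1) hne (fun n => -(n : ℤ)) (fun a b hab => by simpa using hab) h1
  · intro h0
    by_contra hne
    have hfinite := H.finite_entries hfin (|A y 0 0| + |A y 1 0| + |A y 1 1|)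
    have hmaps : ∀ n : ℕ, (α ^ (-(-(n : ℤ))) * y * α ^ (-(n : ℤ))) ∈
        {γ : G | ∀ i j, |A γ i j| ≤ |A y 0 0| + |A y 1 0| + |A y 1 1|} := by
      intro n i j
      rw [hform]
      have a1 := abs_nonneg (A y 0 0)
      have a2 := abs_nonneg (A y 1 0)
      have a3 := abs_nonneg (A y 1 1)
      have a4 : |A y 1 0 * (l ^ 2) ^ (-(n : ℤ))| ≤ |A y 1 0| := by
        rw [abs_mul, abs_of_pos (zpow_pos (show (0 : ℝ) < l ^ 2 by positivity) _)]
        exact mul_le_of_le_one_right a2 (hle n)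
      fin_cases i <;> fin_cases j
      · change |A y 0 0| ≤ _; linarith
      · change |A y 0 1 * (l ^ 2) ^ (-(-(n : ℤ)))| ≤ _; rw [h0, zero_mul, abs_zero]; linarith
      · change |A y 1 0 * (l ^ 2) ^ (-(n : ℤ))| ≤ _; linarith
      · change |A y 1 1| ≤ _; linarith
    refine Set.infinite_of_injective_forall_mem (f := fun n : ℕ => α ^ (-(-(n : ℤ))) * y * α ^ (-(n : ℤ))) ?_ hmaps hfinite
    intro m n h
    have h1 : A (α ^ (-(-(m : ℤ))) * y * α ^ (-(m : ℤ))) 1 0 = A (α ^ (-(-(n : ℤ))) * y * α ^ (-(n : ℤ))) 1 0 :=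
      congrArg (fun g => A g 1 0) h
    rw [hform, hform] at h1
    exact hinj (A y 1 0) hne (fun n => -(n : ℤ)) (fun a b hab => by simpa using hab) h1

/-- If every element is a power of `α` up to a bounded set, `d2` is linearly bounded by `d`. -/
theorem linear_of_coarse (H : HRep d A P P') (H2 : HRep d2 B Q Q')
    (hfin : ∀ r : ℝ, {γ : G | d γ ≤ r}.Finite) {α : G} {l : ℝ} (hl : 1 < l)
    (hα : A α = !![l, 0; 0, l⁻¹]) (R : ℝ)
    (hco : ∀ γ : G, ∃ k : ℤ, ∀ i j, |A (α ^ (-k) * γ) i j| ≤ R) :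
    ∃ C1 C2 : ℝ, 0 ≤ C1 ∧ 0 ≤ C2 ∧ ∀ γ, d2 γ ≤ C1 * d γ + C2 := by
  have hl0 : 0 < l := by linarith
  have hlog := Real.log_pos hl
  have hF := H.finite_entries hfin R
  obtain ⟨m1, hm1⟩ := (hF.image d).bddAbove
  obtain ⟨m2, hm2⟩ := (hF.image d2).bddAbove
  obtain ⟨c, hc, hlow⟩ := H.lower
  have hk : ∀ k : ℤ, (k.natAbs : ℝ) * (2 * Real.log l) + Real.log c ≤ d (α ^ k) := by
    intro k
    rw [H.zpow_eq]
    have h1 := hlow (α ^ k.natAbs)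
    have h2 := entry_sq_le_frob (A (α ^ k.natAbs)) 0 0
    have h3 : A (α ^ k.natAbs) 0 0 = l ^ k.natAbs := by rw [A_pow_diag hα]; simp
    rw [h3] at h2
    have h4 : c * (l ^ k.natAbs) ^ 2 ≤ Real.exp (d (α ^ k.natAbs)) := by
      refine le_trans ?_ h1
      gcongr
    have h5 := Real.log_le_log (by positivity) h4
    rw [Real.log_exp, Real.log_mul hc.ne' (by positivity), Real.log_pow, Real.log_pow] at h5
    push_cast at h5
    linarith
  refine ⟨d2 α / (2 * Real.log l), d2 α / (2 * Real.log l) * (|m1| + |Real.log c|) + |m2|,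
    div_nonneg (H2.nonneg α) (by positivity), ?_, ?_⟩
  · have := div_nonneg (H2.nonneg α) (show 0 ≤ 2 * Real.log l by positivity)
    positivity
  · intro γ
    obtain ⟨k, hkR⟩ := hco γ
    have e1 : d (α ^ (-k) * γ) ≤ |m1| := (hm1 ⟨_, hkR, rfl⟩).trans (le_abs_self _)
    have e2 : d2 (α ^ (-k) * γ) ≤ |m2| := (hm2 ⟨_, hkR, rfl⟩).trans (le_abs_self _)
    have g1 : γ = α ^ k * (α ^ (-k) * γ) := by simp
    have g2 : α ^ k = γ * (α ^ (-k) * γ)⁻¹ := by simp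
    have e3 : d (α ^ k) ≤ d γ + |m1| := by
      rw [g2]
      refine (H.mul _ _).trans ?_
      rw [H.inv]; linarith
    have e4 : d2 γ ≤ k.natAbs * d2 α + |m2| := by
      have := H2.mul (α ^ k) (α ^ (-k) * γ)
      rw [← g1] at this
      have h6 := H2.pow_le α k.natAbs
      rw [← H2.zpow_eq] at h6
      linarith
    have e5 : (k.natAbs : ℝ) ≤ (d γ + (|m1| + |Real.log c|)) / (2 * Real.log l) := by
      rw [le_div_iff₀ (by positivity)]
      have := hk k
      have := neg_abs_le (Real.log c)
      linarith
    have e6 := mul_le_mul_of_nonneg_right e5 (H2.nonneg α)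
    calc d2 γ ≤ _ := e4
      _ ≤ (d γ + (|m1| + |Real.log c|)) / (2 * Real.log l) * d2 α + |m2| := by linarith
      _ = _ := by ring

theorem hyp_diag (H : HRep d A P P') (H2 : HRep d2 B Q Q')
    (hfin : ∀ r : ℝ, {γ : G | d γ ≤ r}.Finite)
    (hshell : ∀ᶠ n : ℕ in Filter.atTop, ∃ γ : G, (n : ℝ) - 1 < d γ ∧ d γ ≤ n) {α : G} {l : ℝ} (hl : 1 < l)
    (hα : A α = !![l, 0; 0, l⁻¹]) : LB d d2 := by
  by_cases hgood : ∃ y, A y 0 0 ≠ 0 ∧ A y 0 1 ≠ 0 ∧ A y 1 0 ≠ 0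
  · obtain ⟨y, h1, h2, h3⟩ := hgood
    exact H.good_cover H2 hl hα y h1 h2 h3
  · have hl0 : 0 < l := by linarith
    have hbad : ∀ y, A y 0 0 = 0 ∨ (A y 0 1 = 0 ∧ A y 1 0 = 0) := by
      intro y
      by_contra h
      push Not at h
      apply hgood
      refine ⟨y, h.1, fun h1 => ?_, fun h1 => ?_⟩
      · exact h.2 h1 ((H.tri_aux hfin hl hα y).2 h1)
      · exact h.2 ((H.tri_aux hfin hl hα y).1 h1) h1
    have hdet : ∀ y, A y 0 0 * A y 1 1 - A y 0 1 * A y 1 0 = 1 := by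
      intro y
      rw [← Matrix.det_fin_two, H.det]
    have hbad' : ∀ y, (A y 0 0 = 0 ∧ A y 1 1 = 0) ∨ (A y 0 1 = 0 ∧ A y 1 0 = 0) := by
      intro y
      rcases hbad y with h | h
      · left
        refine ⟨h, ?_⟩
        have hd := hdet y
        rw [h, zero_mul, zero_sub] at hd
        have hq : A y 0 1 ≠ 0 := by intro h; rw [h] at hd; norm_num at hd
        have h2 := hbad (y * y)
        simp only [map_mul, Matrix.mul_apply, Fin.sum_univ_two, h] at h2
        rcases h2 with h2 | h2
        · linarith
        · have := h2.1
          rw [zero_mul, zero_add] at this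
          exact (mul_eq_zero.1 this).resolve_left hq
      · exact Or.inr h
    have hco : ∀ γ : G, ∃ k : ℤ, ∀ i j, |A (α ^ (-k) * γ) i j| ≤ l := by
      intro γ
      have hent : ∀ k : ℤ, A (α ^ (-k) * γ) = !![l ^ (-k) * A γ 0 0, l ^ (-k) * A γ 0 1; l ^ k * A γ 1 0, l ^ k * A γ 1 1] := by
        intro k
        rw [map_mul, A_zpow_diag hl0.ne' hα]
        ext i j
        fin_cases i <;> fin_cases j <;> simp [Matrix.mul_apply, Fin.sum_univ_two]
      have key : ∀ u v : ℝ, |u * v| = 1 → ∃ k : ℤ, |l ^ (-k) * u| ≤ l ∧ |l ^ k * v| ≤ l := by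
        intro u v huv
        have hu : u ≠ 0 := by rintro rfl; simp at huv
        obtain ⟨k, hk1, hk2⟩ := exists_mem_Ico_zpow (abs_pos.2 hu) hl
        have hk0 : 0 < l ^ k := zpow_pos hl0 k
        refine ⟨k, ?_, ?_⟩
        · rw [abs_mul, abs_of_pos (zpow_pos hl0 _), zpow_neg, inv_mul_le_iff₀ hk0]
          rw [zpow_add_one₀ hl0.ne'] at hk2
          exact hk2.le
        · rw [abs_mul, abs_of_pos hk0]
          have : l ^ k * |v| ≤ |u| * |v| := by gcongr
          rw [← abs_mul, huv] at this
          linarith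
      have hd := hdet γ
      rcases hbad' γ with h | h
      · rw [h.1] at hd
        obtain ⟨k, hk1, hk2⟩ := key (A γ 0 1) (A γ 1 0) (by
          rw [show A γ 0 1 * A γ 1 0 = -1 by linarith]; simp)
        refine ⟨k, fun i j => ?_⟩
        rw [hent, h.1, h.2]
        fin_cases i <;> fin_cases j <;> simp [hl0.le]
        · simpa using hk1
        · simpa using hk2
      · rw [h.1] at hd
        obtain ⟨k, hk1, hk2⟩ := key (A γ 0 0) (A γ 1 1) (by
          rw [show A γ 0 0 * A γ 1 1 = 1 by linarith]; simp)
        refine ⟨k, fun i j => ?_⟩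
        rw [hent, h.1, h.2]
        fin_cases i <;> fin_cases j <;> simp [hl0.le]
        · simpa using hk1
        · simpa using hk2
    obtain ⟨C1, C2, h1, h2, h3⟩ := H.linear_of_coarse H2 hfin hl hα l hco
    exact LB_of_linear hshell C1 C2 h1 h2 h3

theorem diagonalize (M : M2) (hdet : M.det = 1) (htr : 2 < M.trace) :
    ∃ (R R' : M2) (l : ℝ), R' * R = 1 ∧ R * R' = 1 ∧ 1 < l ∧ R' * M * R = !![l, 0; 0, l⁻¹] := by
  rw [Matrix.det_fin_two] at hdet
  rw [Matrix.trace_fin_two] at htr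
  set τ := M 0 0 + M 1 1 with hτ
  set s := √(τ ^ 2 - 4) with hs
  have hs2 : s ^ 2 = τ ^ 2 - 4 := Real.sq_sqrt (by nlinarith)
  have hs0 : 0 < s := Real.sqrt_pos.2 (by nlinarith)
  set l := (τ + s) / 2 with hl
  set m := (τ - s) / 2 with hm
  have hlm : l * m = 1 := by rw [hl, hm]; linear_combination (-1 / 4) * hs2
  have hl1 : 1 < l := by rw [hl]; linarith
  have hsum : l + m = τ := by rw [hl, hm]; ring
  have hne : l ≠ m := by intro h; rw [hl, hm] at h; linarith
  have hminv : m = l⁻¹ := eq_inv_of_mul_eq_one_right hlm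
  have eig : ∀ x : ℝ, x * x - τ * x + 1 = 0 → ∃ a b : ℝ, (a ≠ 0 ∨ b ≠ 0) ∧ M 0 0 * a + M 0 1 * b = x * a ∧
      M 1 0 * a + M 1 1 * b = x * b := by
    intro x hx
    have hd : (M - x • (1 : M2)).det = 0 := by
      rw [Matrix.det_fin_two]
      simp
      rw [hτ] at hx
      linear_combination hx + hdet
    obtain ⟨v, hv, hv0⟩ := Matrix.exists_mulVec_eq_zero_iff.2 hd
    refine ⟨v 0, v 1, ?_, ?_, ?_⟩
    · by_contra h
      push Not at h
      apply hv
      ext i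
      fin_cases i
      · exact h.1
      · exact h.2
    · have := congrFun hv0 0
      simp [Matrix.mulVec, dotProduct, Fin.sum_univ_two] at this
      linarith
    · have := congrFun hv0 1
      simp [Matrix.mulVec, dotProduct, Fin.sum_univ_two] at this
      linarith
  obtain ⟨a, b, hab, e1, e2⟩ := eig l (by rw [← hsum]; linear_combination -hlm)
  obtain ⟨a', b', hab', f1, f2⟩ := eig m (by rw [← hsum]; linear_combination -hlm)
  have hD : a * b' - a' * b ≠ 0 := by
    intro h
    have k1 : (l - m) * (a * b') = 0 := by
      linear_combination (-b') * e1 + b * f1 - (M 0 0 - m) * (-h) 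
    have k2 : (l - m) * (a * a') = 0 := by
      linear_combination (-a') * e1 + a * f1 + M 0 1 * (-h)
    have k3 : (l - m) * (b * b') = 0 := by
      linear_combination (-b') * e2 + b * f2 + M 1 0 * h
    have k4 : (l - m) * (a' * b) = 0 := by linear_combination k1 - (l - m) * h
    have hlm0 : l - m ≠ 0 := sub_ne_zero.2 hne
    simp only [mul_eq_zero, hlm0, false_or] at k1 k2 k3 k4
    tauto
  have hRR : ((a * b' - a' * b)⁻¹ • !![b', -a'; -b, a] : M2) * !![a, a'; b, b'] = 1 := by
    ext i j
    fin_cases i <;> fin_cases j <;> simp [Matrix.mul_apply, Fin.sum_univ_two] <;> field_simp <;> ring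
  refine ⟨!![a, a'; b, b'], (a * b' - a' * b)⁻¹ • !![b', -a'; -b, a], l, hRR,
    mul_eq_one_comm.1 hRR, hl1, ?_⟩
  · have hMR : M * !![a, a'; b, b'] = !![l * a, m * a'; l * b, m * b'] := by
      ext i j
      fin_cases i <;> fin_cases j <;> simp [Matrix.mul_apply, Fin.sum_univ_two] <;> assumption
    rw [mul_assoc, hMR, ← hminv]
    ext i j
    fin_cases i <;> fin_cases j <;> simp [Matrix.mul_apply, Fin.sum_univ_two] <;> field_simp <;> ring

theorem hyp_case (H : HRep d A P P') (H2 : HRep d2 B Q Q')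
    (hfin : ∀ r : ℝ, {γ : G | d γ ≤ r}.Finite)
    (hshell : ∀ᶠ n : ℕ in Filter.atTop, ∃ γ : G, (n : ℝ) - 1 < d γ ∧ d γ ≤ n) {α : G}
    (hα : 2 < |(A α).trace|) : LB d d2 := by
  have htr : 2 < (A (α * α)).trace := by
    have hd := H.det α
    rw [Matrix.det_fin_two] at hd
    rw [Matrix.trace_fin_two] at hα
    rw [map_mul, Matrix.trace_fin_two]
    simp only [Matrix.mul_apply, Fin.sum_univ_two]
    have := sq_abs (A α 0 0 + A α 1 1)
    nlinarith
  obtain ⟨R, R', l, h1, h2, h3, h4⟩ := diagonalize (A (α * α)) (H.det _) htr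
  exact (H.conj R R' h1 h2).hyp_diag H2 hfin hshell h3 (α := α * α) h4

end HRep

theorem elliptic_bound (a b c d : ℝ) (hdet : a * d - b * c = 1) (htr : |a + d| < 2) :
    ∃ R : ℝ, ∀ x y z w : ℝ, x * w - y * z = 1 → |x + w| ≤ 2 →
      (b * z - y * c) ^ 2 + ((a - d) * y - b * (x - w)) * (c * (x - w) - (a - d) * z) ≤ 0 →
      |x| ≤ R ∧ |y| ≤ R ∧ |z| ≤ R ∧ |w| ≤ R := by
  have hτ : (a + d) ^ 2 < 4 := by
    rw [← sq_abs]; nlinarith [abs_nonneg (a + d)]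
  have hb : b ≠ 0 := by
    rintro rfl
    nlinarith [sq_nonneg (a - d)]
  set K := 4 / (4 - (a + d) ^ 2) with hK
  have hK0 : 0 < K := div_pos (by norm_num) (by linarith)
  set T := 1 + K with hT
  have hT0 : 0 < T := by linarith
  refine ⟨1 + T * (|a - d| + |b| + |c|), ?_⟩
  intro x y z w h1 h2 h3
  set u := b * z - y * c with hu
  set v := (a - d) * y - b * (x - w) with hv
  set r := c * (x - w) - (a - d) * z with hr
  have hrel : (a - d) * u + v * c + r * b = 0 := by rw [hu, hv, hr]; ring
  have hq : (b * u - (a - d) / 2 * v) ^ 2 + (1 - (a + d) ^ 2 / 4) * v ^ 2 ≤ 0 := by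
    have e : (b * u - (a - d) / 2 * v) ^ 2 + (1 - (a + d) ^ 2 / 4) * v ^ 2 = b ^ 2 * (u ^ 2 + v * r) := by
      linear_combination (-b * v) * hrel - v ^ 2 * hdet
    rw [e]
    exact mul_nonpos_of_nonneg_of_nonpos (sq_nonneg _) h3
  have hc4 : 0 < 1 - (a + d) ^ 2 / 4 := by linarith
  have hv0 : v = 0 := by
    have : v ^ 2 ≤ 0 := by nlinarith [sq_nonneg (b * u - (a - d) / 2 * v), sq_nonneg v]
    exact pow_eq_zero_iff (two_ne_zero) |>.1 (le_antisymm this (sq_nonneg v))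
  have hu0 : u = 0 := by
    rw [hv0] at hq
    have : (b * u) ^ 2 ≤ 0 := by nlinarith
    have := pow_eq_zero_iff (two_ne_zero) |>.1 (le_antisymm this (sq_nonneg _))
    exact (mul_eq_zero.1 this).resolve_left hb
  set t := y / b with ht
  have hy : y = t * b := by rw [ht]; field_simp
  have hz : z = t * c := by
    have : b * (z - t * c) = 0 := by rw [← hu0, hu, hy]; ring
    have := (mul_eq_zero.1 this).resolve_left hb
    linarith
  have hxw : x - w = t * (a - d) := by
    have : b * (x - w - t * (a - d)) = 0 := by
      have := hv0
      rw [hv, hy] at this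
      linear_combination -this
    have := (mul_eq_zero.1 this).resolve_left hb
    linarith
  have ht2 : t ^ 2 * (4 - (a + d) ^ 2) ≤ 4 := by
    have e : t ^ 2 * (4 - (a + d) ^ 2) = 4 - (x + w) ^ 2 := by
      have e1 : (x - w) ^ 2 = t ^ 2 * (a - d) ^ 2 := by rw [hxw]; ring
      have e2 : y * z = t ^ 2 * (b * c) := by rw [hy, hz]; ring
      linear_combination (-4 * t ^ 2) * hdet + e1 + 4 * h1 + 4 * e2
    rw [e]; linarith [sq_nonneg (x + w)]
  have ht3 : t ^ 2 ≤ K := by rw [hK, le_div_iff₀ (by linarith)]; exact ht2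
  have ht4 : |t| ≤ T := by
    have := sq_abs t
    nlinarith [sq_nonneg (|t| - 1), abs_nonneg t]
  have b1 := abs_nonneg b
  have b2 := abs_nonneg c
  have b3 := abs_nonneg (a - d)
  have c1 : |t| * |b| ≤ T * |b| := by gcongr
  have c2 : |t| * |c| ≤ T * |c| := by gcongr
  have c3 : |t| * |a - d| ≤ T * |a - d| := by gcongr
  have d1 := mul_nonneg hT0.le b1
  have d2 := mul_nonneg hT0.le b2
  have d3 := mul_nonneg hT0.le b3
  have hxw' : |x - w| ≤ T * |a - d| := by rw [hxw, abs_mul]; exact c3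
  rw [abs_le] at h2 hxw'
  have hexp : T * (|a - d| + |b| + |c|) = T * |a - d| + T * |b| + T * |c| := by ring
  rw [hexp]
  clear hq h3 hrel hxw hdet h1
  refine ⟨?_, ?_, ?_, ?_⟩
  · rw [abs_le]; constructor <;> linarith [h2.1, h2.2, hxw'.1, hxw'.2]
  · rw [hy, abs_mul]; linarith
  · rw [hz, abs_mul]; linarith
  · rw [abs_le]; constructor <;> linarith [h2.1, h2.2, hxw'.1, hxw'.2]

theorem unip_conj (N : M2) (hdet : N.det = 1) (htr : N.trace = 2) (hN : N ≠ 1) :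
    ∃ (R R' : M2) (t : ℝ), R' * R = 1 ∧ R * R' = 1 ∧ t ≠ 0 ∧ R' * N * R = !![1, t; 0, 1] := by
  rw [Matrix.det_fin_two] at hdet
  rw [Matrix.trace_fin_two] at htr
  have key : ∀ (R R' : M2) (t : ℝ), R' * R = 1 → R' * N * R = !![1, t; 0, 1] →
      R' * R = 1 ∧ R * R' = 1 ∧ t ≠ 0 ∧ R' * N * R = !![1, t; 0, 1] := by
    intro R R' t h1 h2
    have h1' : R * R' = 1 := mul_eq_one_comm.1 h1
    refine ⟨h1, h1', ?_, h2⟩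
    rintro rfl
    apply hN
    have h3 : (!![1, 0; 0, 1] : M2) = 1 := Matrix.one_fin_two.symm
    calc N = (R * R') * N * (R * R') := by rw [h1']; simp
      _ = R * (R' * N * R) * R' := by simp only [mul_assoc]
      _ = 1 := by rw [h2, h3, mul_one, h1']
  rw [Matrix.eta_fin_two N] at key ⊢
  generalize N 0 0 = n0 at *
  generalize N 0 1 = b at *
  generalize N 1 0 = c at *
  generalize N 1 1 = n1 at *
  obtain rfl : n1 = 2 - n0 := by linarith
  obtain ⟨n, rfl⟩ : ∃ n, n0 = 1 + n := ⟨n0 - 1, by ring⟩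
  have hn : n ^ 2 + b * c = 0 := by linear_combination -hdet
  by_cases hc : c = 0
  · subst hc
    have hn0 : n = 0 := by
      have : n ^ 2 = 0 := by linarith
      exact pow_eq_zero_iff (two_ne_zero) |>.1 this
    subst hn0
    refine ⟨1, 1, b, key 1 1 b (by simp) ?_⟩
    ext i j
    fin_cases i <;> fin_cases j <;> simp <;> norm_num
  · have hs : n ^ 2 + c ^ 2 ≠ 0 := by positivity
    set s := (n ^ 2 + c ^ 2)⁻¹ with hsd
    have hs1 : s * (n ^ 2 + c ^ 2) = 1 := inv_mul_cancel₀ hs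
    refine ⟨!![n, -c; c, n], !![s * n, s * c; - (s * c), s * n], s * (n ^ 2 * (b - c) - c * (c ^ 2 + n ^ 2)), key _ _ _ ?_ ?_⟩
    · ext i j
      fin_cases i <;> fin_cases j <;> simp [Matrix.mul_apply, Fin.sum_univ_two]
      · linear_combination hs1
      · ring
      · ring
      · linear_combination hs1
    · rw [Matrix.mul_fin_two, Matrix.mul_fin_two]
      ext i j
      fin_cases i <;> fin_cases j <;> simp
      · linear_combination hs1 + s * n * hn
      · linear_combination 0 * hn
      · linear_combination - s * c * hn
      · linear_combination hs1 - s * n * hn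

theorem trace_comm_formula (a b c d x y z w : ℝ) (h1 : a * d - b * c = 1) (h2 : x * w - y * z = 1) :
    ((!![a, b; c, d] : M2) * !![x, y; z, w] * !![d, -b; -c, a] * !![w, -y; -z, x]).trace =
    2 + ((b * z - y * c) ^ 2 + ((a - d) * y - b * (x - w)) * (c * (x - w) - (a - d) * z)) := by
  have : (2 : ℝ) = 2 * ((a * d - b * c) * (x * w - y * z)) := by rw [h1, h2]; ring
  rw [this, Matrix.mul_fin_two, Matrix.mul_fin_two, Matrix.mul_fin_two, Matrix.trace_fin_two]
  simp only [Matrix.of_apply, Matrix.cons_val', Matrix.cons_val_zero, Matrix.cons_val_one, Matrix.cons_val_fin_one]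
  ring

namespace HRep

variable {G : Type*} [Group G] {d d2 : G → ℝ} {A B : G →* M2} {P P' Q Q' : M2}

theorem inv_form (H : HRep d A P P') (g : G) :
    A g⁻¹ = !![A g 1 1, -A g 0 1; -A g 1 0, A g 0 0] := by
  have h1 : A g * A g⁻¹ = 1 := by rw [← map_mul]; simp
  have hd := H.det g
  rw [Matrix.det_fin_two] at hd
  have h2 : !![A g 1 1, -A g 0 1; -A g 1 0, A g 0 0] * A g = 1 := by
    ext i j
    fin_cases i <;> fin_cases j <;> simp [Matrix.mul_apply, Fin.sum_univ_two] <;> linarith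
  exact (left_inv_eq_right_inv h2 h1).symm

theorem infinite_of_shell (hfin : ∀ r : ℝ, {γ : G | d γ ≤ r}.Finite)
    (hshell : ∀ᶠ n : ℕ in Filter.atTop, ∃ γ : G, (n : ℝ) - 1 < d γ ∧ d γ ≤ n) :
    ¬ (Set.univ : Set G).Finite := by
  intro hu
  obtain ⟨M, hM⟩ := (hu.image d).bddAbove
  obtain ⟨n, ⟨γ, hγ, -⟩, hn⟩ := (hshell.and (Filter.eventually_ge_atTop (⌈M⌉₊ + 1))).exists
  have h1 : d γ ≤ M := hM ⟨γ, trivial, rfl⟩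
  have h2 : ((⌈M⌉₊ : ℝ) + 1) ≤ n := by exact_mod_cast hn
  linarith [Nat.le_ceil M]

theorem no_elliptic (H : HRep d A P P') (hfin : ∀ r : ℝ, {γ : G | d γ ≤ r}.Finite)
    (hinf : ¬ (Set.univ : Set G).Finite)
    (htr : ∀ γ, |(A γ).trace| ≤ 2) (e : G) : |(A e).trace| = 2 := by
  refine le_antisymm (htr e) (le_of_not_gt fun hlt => hinf ?_)
  have hde := H.det e
  rw [Matrix.det_fin_two] at hde
  rw [Matrix.trace_fin_two] at hlt
  obtain ⟨R, hR⟩ := elliptic_bound _ _ _ _ hde hlt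
  refine (H.finite_entries hfin R).subset fun h _ => ?_
  have hdh := H.det h
  rw [Matrix.det_fin_two] at hdh
  have ht := htr h
  rw [Matrix.trace_fin_two] at ht
  have hk := (abs_le.1 (htr (e * h * e⁻¹ * h⁻¹))).2
  rw [map_mul, map_mul, map_mul, H.inv_form, H.inv_form, Matrix.eta_fin_two (A e), Matrix.eta_fin_two (A h)] at hk
  have hform := trace_comm_formula _ _ _ _ _ _ _ _ hde hdh
  have hk2 : _ ≤ (2 : ℝ) := hform.symm.le.trans hk
  have := hR _ _ _ _ hdh ht (by linarith)
  intro i j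
  fin_cases i <;> fin_cases j
  · exact this.1
  · exact this.2.1
  · exact this.2.2.1
  · exact this.2.2.2

theorem exists_unip (H : HRep d A P P') (hfin : ∀ r : ℝ, {γ : G | d γ ≤ r}.Finite)
    (hinf : ¬ (Set.univ : Set G).Finite)
    (htr : ∀ γ, |(A γ).trace| ≤ 2) : ∃ p : G, (A p).trace = 2 ∧ A p ≠ 1 := by
  by_contra hcon
  push Not at hcon
  apply hinf
  refine (H.finite_entries hfin 1).subset fun g _ => ?_
  have h2 := H.no_elliptic hfin hinf htr g
  have hd := H.det g
  rw [Matrix.det_fin_two] at hd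
  rw [Matrix.trace_fin_two] at h2
  have hsq : (A g 0 0 + A g 1 1) ^ 2 = 4 := by rw [← sq_abs, h2]; norm_num
  have h3 := hcon (g * g) (by
    rw [map_mul, Matrix.trace_fin_two]
    simp only [Matrix.mul_apply, Fin.sum_univ_two]
    linear_combination hsq - 2 * hd)
  have e00 := congrFun (congrFun h3 0) 0
  have e01 := congrFun (congrFun h3 0) 1
  have e10 := congrFun (congrFun h3 1) 0
  have e11 := congrFun (congrFun h3 1) 1
  rw [map_mul] at e00 e01 e10 e11
  simp only [Matrix.mul_apply, Fin.sum_univ_two] at e00 e01 e10 e11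
  simp at e00 e01 e10 e11
  have hne : A g 0 0 + A g 1 1 ≠ 0 := by intro h; rw [h] at hsq; norm_num at hsq
  have k01 : A g 0 1 = 0 := by
    have : A g 0 1 * (A g 0 0 + A g 1 1) = 0 := by linear_combination e01
    exact (mul_eq_zero.1 this).resolve_right hne
  have k10 : A g 1 0 = 0 := by
    have : A g 1 0 * (A g 0 0 + A g 1 1) = 0 := by linear_combination e10
    exact (mul_eq_zero.1 this).resolve_right hne
  rw [k01, k10] at e00 e11
  intro i j
  fin_cases i <;> fin_cases j
  · change |A g 0 0| ≤ 1; rw [← sq_le_one_iff_abs_le_one]; linarith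
  · change |A g 0 1| ≤ 1; rw [k01]; simp
  · change |A g 1 0| ≤ 1; rw [k10]; simp
  · change |A g 1 1| ≤ 1; rw [← sq_le_one_iff_abs_le_one]; linarith

end HRep

/-- Chebyshev-type sequence with `q ^ (n+1) = s (n+1) q - s n`. -/
noncomputable def cheb (τ : ℝ) : ℕ → ℝ × ℝ
  | 0 => (0, 1)
  | n + 1 => ((cheb τ n).2, τ * (cheb τ n).2 - (cheb τ n).1)

theorem cheb_inv (τ : ℝ) (n : ℕ) :
    (cheb τ n).1 ^ 2 - τ * ((cheb τ n).1 * (cheb τ n).2) + (cheb τ n).2 ^ 2 = 1 := by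
  induction n with
  | zero => simp [cheb]
  | succ k ih => simp only [cheb]; linear_combination ih

theorem cheb_bound (τ : ℝ) (hτ : |τ| ≤ 2) (n : ℕ) : |(cheb τ n).1| ≤ n ∧ |(cheb τ n).2| ≤ n + 1 := by
  have step : ∀ n, |(cheb τ n).2| ≤ |(cheb τ n).1| + 1 := by
    intro n
    have h := cheb_inv τ n
    set x := (cheb τ n).1
    set y := (cheb τ n).2
    have h1 : τ * (x * y) ≤ 2 * (|x| * |y|) := by
      rw [← abs_mul x y]
      calc τ * (x * y) ≤ |τ * (x * y)| := le_abs_self _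
        _ = |τ| * |x * y| := abs_mul _ _
        _ ≤ 2 * |x * y| := by gcongr
    have h2 : (|y| - |x|) ^ 2 ≤ 1 := by
      have := sq_abs x
      have := sq_abs y
      nlinarith
    have := (abs_le.1 ((sq_le_one_iff_abs_le_one _).1 h2)).2
    linarith
  induction n with
  | zero => simp [cheb]
  | succ k ih =>
    have h1 : (cheb τ (k + 1)).1 = (cheb τ k).2 := rfl
    have h2 := step (k + 1)
    rw [h1] at h2 ⊢
    push_cast
    exact ⟨ih.2, by linarith [ih.2]⟩

theorem ch2 (q : M2) (hq : q.det = 1) : q * q = q.trace • q - 1 := by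
  rw [Matrix.det_fin_two] at hq
  rw [Matrix.trace_fin_two]
  ext i j
  fin_cases i <;> fin_cases j <;> simp [Matrix.mul_apply, Fin.sum_univ_two]
  · linear_combination -hq
  · ring
  · ring
  · linear_combination -hq

theorem pow_cheb (q : M2) (hq : q.det = 1) (n : ℕ) :
    q ^ (n + 1) = (cheb q.trace n).2 • q - (cheb q.trace n).1 • (1 : M2) := by
  induction n with
  | zero => simp [cheb]
  | succ k ih =>
    rw [pow_succ, ih, sub_mul, smul_mul_assoc, ch2 q hq]
    simp only [cheb]
    simp only [smul_mul_assoc, one_mul, smul_sub, sub_smul, smul_smul]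
    rw [mul_comm q.trace]
    abel

theorem frob_pow_le (q : M2) (hq : q.det = 1) (hτ : |q.trace| ≤ 2) :
    ∃ K : ℝ, 0 < K ∧ ∀ n : ℕ, frob (q ^ n) ≤ K * ((n : ℝ) + 1) ^ 2 := by
  set S := |q 0 0| + |q 0 1| + |q 1 0| + |q 1 1| with hS
  have hS0 : 0 ≤ S := by positivity
  have hSij : ∀ i j, |q i j| ≤ S := by
    have a1 := abs_nonneg (q 0 0)
    have a2 := abs_nonneg (q 0 1)
    have a3 := abs_nonneg (q 1 0)
    have a4 := abs_nonneg (q 1 1)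
    intro i j
    fin_cases i <;> fin_cases j
    · change |q 0 0| ≤ S; linarith
    · change |q 0 1| ≤ S; linarith
    · change |q 1 0| ≤ S; linarith
    · change |q 1 1| ≤ S; linarith
  refine ⟨4 * (S + 1) ^ 2, by positivity, fun n => ?_⟩
  have h1ij : ∀ i j, |(1 : M2) i j| ≤ 1 := by
    intro i j
    fin_cases i <;> fin_cases j <;> simp
  have : ∀ i j, |(q ^ n) i j| ≤ (S + 1) * (n + 1) := by
    intro i j
    cases n with
    | zero =>
      rw [pow_zero]
      have := h1ij i j
      simp only [Nat.cast_zero]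
      linarith
    | succ k =>
      rw [pow_cheb q hq]
      obtain ⟨b1, b2⟩ := cheb_bound _ hτ k
      have e : (((cheb q.trace k).2 • q - (cheb q.trace k).1 • (1 : M2)) : M2) i j =
        (cheb q.trace k).2 * q i j - (cheb q.trace k).1 * (1 : M2) i j := by simp
      rw [e]
      have h3 : |(cheb q.trace k).2 * q i j| ≤ (k + 1) * S := by
        rw [abs_mul]; gcongr; exact hSij i j
      have h4 : |(cheb q.trace k).1 * (1 : M2) i j| ≤ k * 1 := by
        rw [abs_mul]; gcongr; exact h1ij i j
      have := abs_sub ((cheb q.trace k).2 * q i j) ((cheb q.trace k).1 * (1 : M2) i j)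
      push_cast
      have hk : (0 : ℝ) ≤ k := Nat.cast_nonneg k
      nlinarith
  have := frob_le_of_entry _ _ this
  rw [mul_pow] at this
  linarith

theorem trace_pow_ge (q : M2) (hq : q.det = 1) (hτ : 2 < |q.trace|) (n : ℕ) :
    |q.trace| / 2 * |(q ^ n).trace| ≤ |(q ^ (n + 1)).trace| := by
  induction n with
  | zero => simp
  | succ k ih =>
    have e : (q ^ (k + 2)).trace = q.trace * (q ^ (k + 1)).trace - (q ^ k).trace := by
      rw [pow_add q k 2, pow_two, ch2 q hq, mul_sub, mul_one, mul_smul_comm, ← pow_succ]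
      simp
    rw [e]
    set τ := q.trace
    have h1 : |τ| * |(q ^ (k + 1)).trace| - |(q ^ k).trace| ≤ |τ * (q ^ (k + 1)).trace - (q ^ k).trace| := by
      rw [← abs_mul]; exact abs_sub_abs_le_abs_sub _ _
    refine le_trans ?_ h1
    have h2 := abs_nonneg (q ^ k).trace
    have h3 := abs_nonneg (q ^ (k + 1)).trace
    have h4 : 0 ≤ (|τ| / 2 - 1) * |(q ^ k).trace| := mul_nonneg (by linarith) h2
    have h5 : 0 ≤ (|τ| / 2 - 1) * |(q ^ (k + 1)).trace| := mul_nonneg (by linarith) h3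
    linarith

theorem frob_pow_ge (q : M2) (hq : q.det = 1) (hτ : 2 < |q.trace|) (n : ℕ) :
    (|q.trace| / 2) ^ n ≤ frob (q ^ n) := by
  have h1 : ∀ n : ℕ, 2 * (|q.trace| / 2) ^ n ≤ |(q ^ n).trace| := by
    intro n
    induction n with
    | zero => simp
    | succ k ih =>
      refine le_trans ?_ (trace_pow_ge q hq hτ k)
      rw [pow_succ]
      nlinarith
  have h2 := h1 n
  have h3 : 1 ≤ (|q.trace| / 2) ^ n := one_le_pow₀ (by linarith)
  have h4 := sq_abs (q ^ n).trace
  rw [Matrix.trace_fin_two (q ^ n)] at h2 h4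
  unfold frob
  set u := (|q.trace| / 2) ^ n
  set v := |(q ^ n) 0 0 + (q ^ n) 1 1|
  nlinarith [sq_nonneg ((q ^ n) 0 0 - (q ^ n) 1 1), sq_nonneg ((q ^ n) 0 1), sq_nonneg ((q ^ n) 1 0)]

namespace HRep

variable {G : Type*} [Group G] {d d2 : G → ℝ} {A B : G →* M2} {P P' Q Q' : M2}

theorem unip_pow {p : G} {t : ℝ} (hp : A p = !![1, t; 0, 1]) (n : ℕ) : A (p ^ n) = !![1, n * t; 0, 1] := by
  induction n with
  | zero => simp [Matrix.one_fin_two]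
  | succ k ih =>
    rw [pow_succ, map_mul, ih, hp, Matrix.mul_fin_two]
    ext i j
    fin_cases i <;> fin_cases j <;> simp
    ring

theorem unip_zpow (H : HRep d A P P') {p : G} {t : ℝ} (hp : A p = !![1, t; 0, 1]) (k : ℤ) :
    A (p ^ k) = !![1, k * t; 0, 1] := by
  obtain ⟨n, rfl | rfl⟩ := k.eq_nat_or_neg
  · rw [zpow_natCast, unip_pow hp]; simp
  · rw [zpow_neg, zpow_natCast, H.inv_form, unip_pow hp]
    ext i j
    fin_cases i <;> fin_cases j <;> simp

theorem para_shape (H : HRep d A P P') (htr : ∀ γ, |(A γ).trace| ≤ 2) {p : G} {t : ℝ} (ht : t ≠ 0)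
    (hp : A p = !![1, t; 0, 1]) (x : G) : A x 1 0 = 0 ∧ A x 0 0 = A x 1 1 ∧ A x 1 1 ^ 2 = 1 := by
  have h0 : A x 1 0 = 0 := by
    by_contra hne
    have hc : 0 < |t * A x 1 0| := abs_pos.2 (mul_ne_zero ht hne)
    obtain ⟨n, hn⟩ := exists_nat_gt (4 / |t * A x 1 0|)
    rw [div_lt_iff₀ hc] at hn
    have h1 := htr (p ^ n * x)
    have h2 := htr x
    rw [map_mul, unip_pow hp, Matrix.trace_fin_two] at h1
    rw [Matrix.trace_fin_two] at h2
    simp only [Matrix.mul_apply, Fin.sum_univ_two] at h1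
    simp at h1
    have h3 : (n : ℝ) * |t * A x 1 0| = |n * (t * A x 1 0)| := by rw [abs_mul (n : ℝ), Nat.abs_cast]
    rw [h3] at hn
    rw [abs_le] at h1 h2
    have h4 : |n * (t * A x 1 0)| ≤ 4 := by
      rw [abs_le]; constructor <;> linarith
    linarith
  have hd := H.det x
  rw [Matrix.det_fin_two, h0] at hd
  have h2 := htr x
  rw [Matrix.trace_fin_two] at h2
  have h3 : (A x 0 0 + A x 1 1) ^ 2 ≤ 4 := by
    rw [← sq_abs]; nlinarith [abs_nonneg (A x 0 0 + A x 1 1)]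
  have h4 : (A x 0 0 - A x 1 1) ^ 2 ≤ 0 := by nlinarith
  have h5 : A x 0 0 - A x 1 1 = 0 := pow_eq_zero_iff (two_ne_zero) |>.1 (le_antisymm h4 (sq_nonneg _))
  have h6 : A x 0 0 = A x 1 1 := by linarith
  refine ⟨h0, h6, ?_⟩
  rw [h6] at hd
  linarith

theorem para_coarse (H : HRep d A P P') (htr : ∀ γ, |(A γ).trace| ≤ 2) {p : G} {t : ℝ} (ht : t ≠ 0)
    (hp : A p = !![1, t; 0, 1]) (x : G) : ∃ k : ℤ, ∀ i j, |A (p ^ (-k) * x) i j| ≤ 1 + |t| := by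
  obtain ⟨h0, h1, h2⟩ := H.para_shape htr ht hp x
  have hne : A x 1 1 ≠ 0 := by intro h; rw [h] at h2; norm_num at h2
  have habs : |A x 1 1| = 1 := by
    have := sq_abs (A x 1 1)
    rw [h2] at this
    nlinarith [abs_nonneg (A x 1 1)]
  refine ⟨⌊A x 0 1 / (t * A x 1 1)⌋, ?_⟩
  set z := A x 0 1 / (t * A x 1 1) with hz
  have e : A (p ^ (-⌊z⌋) * x) = !![A x 1 1, t * A x 1 1 * Int.fract z; 0, A x 1 1] := by
    have hx01 : A x 0 1 = t * A x 1 1 * z := by rw [hz]; field_simp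
    rw [map_mul, H.unip_zpow hp, Matrix.eta_fin_two (A x), Matrix.mul_fin_two, h0, h1, hx01]
    have := Int.floor_add_fract z
    ext i j
    fin_cases i <;> fin_cases j <;> simp
    linear_combination (-t * A x 1 1) * this
  rw [e]
  have ht0 := abs_nonneg t
  have h3 : |t * A x 1 1 * Int.fract z| ≤ |t| := by
    rw [abs_mul, abs_mul, habs, mul_one, abs_of_nonneg (Int.fract_nonneg z)]
    exact mul_le_of_le_one_right ht0 (Int.fract_lt_one z).le
  intro i j
  fin_cases i <;> fin_cases j
  · change |A x 1 1| ≤ 1 + |t|; linarith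
  · change |t * A x 1 1 * Int.fract z| ≤ 1 + |t|; linarith
  · change |(0 : ℝ)| ≤ 1 + |t|; rw [abs_zero]; linarith
  · change |A x 1 1| ≤ 1 + |t|; linarith

end HRep

theorem poly_geom_summable (m : ℕ) {r : ℝ} (hr0 : 0 < r) (hr : r < 1) :
    Summable fun k : ℤ => ((k.natAbs : ℝ) + 1) ^ m * r ^ k.natAbs := by
  have h : Summable fun n : ℕ => ((n : ℝ) + 1) ^ m * r ^ n := by
    have h1 : Summable fun n : ℕ => (n : ℝ) ^ m * r ^ n :=
      summable_pow_mul_geometric_of_norm_lt_one m (by rw [Real.norm_eq_abs, abs_of_pos hr0]; exact hr)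
    have h2 := ((summable_nat_add_iff 1).2 h1).mul_left r⁻¹
    refine h2.congr fun n => ?_
    push_cast
    rw [pow_succ]
    field_simp
  refine Summable.of_nat_of_neg ?_ ?_
  · simpa using h
  · simpa using h

namespace HRep

variable {G : Type*} [Group G] {d d2 : G → ℝ} {A B : G →* M2} {P P' Q Q' : M2}

theorem para_diag (H : HRep d A P P') (H2 : HRep d2 B Q Q')
    (hfin : ∀ r : ℝ, {γ : G | d γ ≤ r}.Finite)
    (hshell : ∀ᶠ n : ℕ in Filter.atTop, ∃ γ : G, (n : ℝ) - 1 < d γ ∧ d γ ≤ n)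
    (htr : ∀ γ, |(A γ).trace| ≤ 2) {p : G} {t0 : ℝ} (ht0 : t0 ≠ 0) (hp : A p = !![1, t0; 0, 1]) :
    LB d d2 ∨ ∀ a b : ℝ, 0 ≤ a → 0 < b → ∀ t : ℝ,
      Summable fun γ : G => Real.exp (-(a * d γ + b * d2 γ) - t * d γ) := by
  have hF := H.finite_entries hfin (1 + |t0|)
  set F : Set G := {γ : G | ∀ i j, |A γ i j| ≤ 1 + |t0|} with hFdef
  choose κ hκ using H.para_coarse htr ht0 hp
  have hκF : ∀ γ, p ^ (-κ γ) * γ ∈ F := hκ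
  obtain ⟨D, hD⟩ : ∃ D : ℝ, ∀ f ∈ F, d f ≤ D := by
    obtain ⟨D, hD⟩ := (hF.image d).bddAbove
    exact ⟨D, fun f hf => hD ⟨f, hf, rfl⟩⟩
  obtain ⟨D2, hD2⟩ : ∃ D : ℝ, ∀ f ∈ F, d2 f ≤ D := by
    obtain ⟨D, hD⟩ := (hF.image d2).bddAbove
    exact ⟨D, fun f hf => hD ⟨f, hf, rfl⟩⟩
  have hγ : ∀ γ, γ = p ^ (κ γ) * (p ^ (-κ γ) * γ) := fun γ => by rw [← mul_assoc, ← zpow_add]; simp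
  have hγ' : ∀ γ, p ^ (κ γ) = γ * (p ^ (-κ γ) * γ)⁻¹ := fun γ => by simp
  have upd : ∀ γ, d γ ≤ d (p ^ κ γ) + D := fun γ => by
    have h1 := H.mul (p ^ κ γ) (p ^ (-κ γ) * γ)
    rw [← hγ γ] at h1
    linarith [hD _ (hκF γ)]
  have upd2 : ∀ γ, d2 γ ≤ d2 (p ^ κ γ) + D2 := fun γ => by
    have h1 := H2.mul (p ^ κ γ) (p ^ (-κ γ) * γ)
    rw [← hγ γ] at h1
    linarith [hD2 _ (hκF γ)]
  have lod : ∀ γ, d (p ^ κ γ) ≤ d γ + D := fun γ => by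
    have h1 := H.mul γ (p ^ (-κ γ) * γ)⁻¹
    rw [← hγ' γ, H.inv] at h1
    linarith [hD _ (hκF γ)]
  have lod2 : ∀ γ, d2 (p ^ κ γ) ≤ d2 γ + D2 := fun γ => by
    have h1 := H2.mul γ (p ^ (-κ γ) * γ)⁻¹
    rw [← hγ' γ, H2.inv] at h1
    linarith [hD2 _ (hκF γ)]
  have frobp : ∀ n : ℕ, _root_.frob (A (p ^ n)) = 2 + (n : ℝ) ^ 2 * t0 ^ 2 := by
    intro n
    rw [unip_pow hp]
    simp [_root_.frob]
    ring
  have ht2 : 0 < t0 ^ 2 := by positivity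
  by_cases hq : |(B p).trace| ≤ 2
  · left
    obtain ⟨K, hK, hKn⟩ := frob_pow_le (B p) (H2.det p) hq
    obtain ⟨c, hc, hlow⟩ := H.lower
    obtain ⟨c2, hc2, hup⟩ := H2.upper
    set L := 1 + 2 / t0 ^ 2 with hL
    have hL0 : 0 < L := by positivity
    have hnat : ∀ n : ℕ, d2 (p ^ n) ≤ d (p ^ n) + Real.log (c2 * K * L / c) := by
      intro n
      have h1 := hup (p ^ n)
      have h2 := hlow (p ^ n)
      rw [frobp] at h2
      rw [map_pow] at h1
      have h3 := hKn n
      have h4 : ((n : ℝ) + 1) ^ 2 ≤ L * (2 + (n : ℝ) ^ 2 * t0 ^ 2) := by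
        have : L * (2 + (n : ℝ) ^ 2 * t0 ^ 2) = 2 + 4 / t0 ^ 2 + (n : ℝ) ^ 2 * t0 ^ 2 + 2 * (n : ℝ) ^ 2 := by
          rw [hL]; field_simp; ring
        rw [this]
        have : 0 < 4 / t0 ^ 2 := by positivity
        nlinarith [sq_nonneg ((n : ℝ) - 1), mul_nonneg (sq_nonneg (n : ℝ)) ht2.le]
      have h5 : Real.exp (d2 (p ^ n)) ≤ c2 * K * L / c * Real.exp (d (p ^ n)) := by
        calc Real.exp (d2 (p ^ n)) ≤ c2 * _root_.frob (B p ^ n) := h1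
          _ ≤ c2 * (K * (L * (2 + (n : ℝ) ^ 2 * t0 ^ 2))) := by
              gcongr; exact h3.trans (by gcongr)
          _ = c2 * K * L / c * (c * (2 + (n : ℝ) ^ 2 * t0 ^ 2)) := by field_simp
          _ ≤ c2 * K * L / c * Real.exp (d (p ^ n)) := by gcongr
      have h6 : Real.exp (d2 (p ^ n)) ≤ Real.exp (d (p ^ n) + Real.log (c2 * K * L / c)) := by
        rw [Real.exp_add, Real.exp_log (by positivity)]; linarith
      exact Real.exp_le_exp.1 h6
    refine LB_of_linear hshell 1 |D + D2 + Real.log (c2 * K * L / c)| zero_le_one (abs_nonneg _) fun γ => ?_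
    have h1 := upd2 γ
    have h2 := lod γ
    have h3 := hnat (κ γ).natAbs
    rw [← H2.zpow_eq, ← H.zpow_eq] at h3
    linarith [le_abs_self (D + D2 + Real.log (c2 * K * L / c))]
  · right
    push Not at hq
    intro a b ha hb t
    obtain ⟨c, hc, hup⟩ := H.upper
    obtain ⟨c2, hc2, hlow⟩ := H2.lower
    set μ := |(B p).trace| / 2 with hμ
    have hμ1 : 1 < μ := by linarith
    have hμ0 : 0 < μ := by linarith
    obtain ⟨m, hm⟩ := exists_nat_ge |t|
    set r := Real.exp (-(b * Real.log μ)) with hr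
    have hr1 : r < 1 := by
      rw [hr, Real.exp_lt_one_iff]
      have := mul_pos hb (Real.log_pos hμ1)
      linarith
    have hlogd : ∀ n : ℕ, Real.exp (m * d (p ^ n)) ≤ (c * (2 + t0 ^ 2)) ^ m * ((n : ℝ) + 1) ^ (2 * m) := by
      intro n
      rw [Real.exp_nat_mul, pow_mul, ← mul_pow]
      gcongr
      have h1 := hup (p ^ n)
      rw [frobp] at h1
      refine h1.trans ?_
      rw [mul_assoc]
      gcongr
      have hn : (0 : ℝ) ≤ n := Nat.cast_nonneg n
      nlinarith [mul_nonneg hn ht2.le]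
    have hd2n : ∀ n : ℕ, Real.exp (-(b * d2 (p ^ n))) ≤ Real.exp (-(b * Real.log c2)) * r ^ n := by
      intro n
      have h1 := hlow (p ^ n)
      rw [map_pow] at h1
      have h2 := frob_pow_ge (B p) (H2.det p) hq n
      have h3 : c2 * μ ^ n ≤ Real.exp (d2 (p ^ n)) := le_trans (by gcongr) h1
      have h4 : Real.log c2 + n * Real.log μ ≤ d2 (p ^ n) := by
        have := Real.log_le_log (by positivity) h3
        rwa [Real.log_exp, Real.log_mul hc2.ne' (by positivity), Real.log_pow] at this
      rw [hr, ← Real.exp_nat_mul, ← Real.exp_add]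
      apply Real.exp_le_exp.2
      nlinarith
    set C := Real.exp (m * |D| + b * D2) * ((c * (2 + t0 ^ 2)) ^ m * Real.exp (-(b * Real.log c2))) with hC
    have hFfin : Finite F := hF.to_subtype
    have hsum : Summable fun x : ℤ × F =>
        (C * (((x.1.natAbs : ℝ) + 1) ^ (2 * m) * r ^ x.1.natAbs)) * (1 : ℝ) := by
      have s1 := (poly_geom_summable (2 * m) (Real.exp_pos (-(b * Real.log μ))) hr1).mul_left C
      have s2 : Summable fun _ : F => (1 : ℝ) := Summable.of_finite
      exact s1.mul_of_nonneg s2 (fun k => by positivity) (fun _ => zero_le_one)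
    let φ : G → ℤ × F := fun γ => (κ γ, ⟨p ^ (-κ γ) * γ, hκF γ⟩)
    have hφ : Function.Injective φ := by
      intro x y hxy
      have h1 : κ x = κ y := congrArg Prod.fst hxy
      have h2 : p ^ (-κ x) * x = p ^ (-κ y) * y := congrArg (fun z => (z.2 : G)) hxy
      rw [h1] at h2
      exact mul_left_cancel h2
    refine Summable.of_nonneg_of_le (fun γ => (Real.exp_pos _).le) (fun γ => ?_) (hsum.comp_injective hφ)
    change _ ≤ (C * ((((κ γ).natAbs : ℝ) + 1) ^ (2 * m) * r ^ (κ γ).natAbs)) * (1 : ℝ)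
    have k1 := hlogd (κ γ).natAbs
    have k2 := hd2n (κ γ).natAbs
    rw [← H.zpow_eq] at k1
    rw [← H2.zpow_eq] at k2
    have k3 : -(a * d γ + b * d2 γ) - t * d γ ≤
        (m * |D| + b * D2) + (m * d (p ^ κ γ) + -(b * d2 (p ^ κ γ))) := by
      have g1 := upd γ
      have g2 := lod2 γ
      have g3 := H.nonneg γ
      have g4 : 0 ≤ a * d γ := mul_nonneg ha g3
      have g5 : -(t * d γ) ≤ m * d γ := by
        have : -t ≤ m := (neg_le_abs t).trans hm
        have := mul_le_mul_of_nonneg_right this g3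
        linarith
      have g6 : (m : ℝ) * d γ ≤ m * (d (p ^ κ γ) + |D|) := by
        gcongr; linarith [le_abs_self D]
      have g7 : b * d2 (p ^ κ γ) ≤ b * (d2 γ + D2) := by gcongr
      rw [mul_add] at g6 g7
      linarith
    calc Real.exp (-(a * d γ + b * d2 γ) - t * d γ)
        ≤ Real.exp ((m * |D| + b * D2) + (m * d (p ^ κ γ) + -(b * d2 (p ^ κ γ)))) := Real.exp_le_exp.2 k3
      _ = Real.exp (m * |D| + b * D2) * (Real.exp (m * d (p ^ κ γ)) * Real.exp (-(b * d2 (p ^ κ γ)))) := by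
          rw [Real.exp_add, Real.exp_add (m * d (p ^ κ γ))]
      _ ≤ Real.exp (m * |D| + b * D2) * (((c * (2 + t0 ^ 2)) ^ m * (((κ γ).natAbs : ℝ) + 1) ^ (2 * m)) *
            (Real.exp (-(b * Real.log c2)) * r ^ (κ γ).natAbs)) := by
          gcongr
      _ = (C * ((((κ γ).natAbs : ℝ) + 1) ^ (2 * m) * r ^ (κ γ).natAbs)) * (1 : ℝ) := by
          rw [hC]; ring

theorem para_case (H : HRep d A P P') (H2 : HRep d2 B Q Q')
    (hfin : ∀ r : ℝ, {γ : G | d γ ≤ r}.Finite)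
    (hshell : ∀ᶠ n : ℕ in Filter.atTop, ∃ γ : G, (n : ℝ) - 1 < d γ ∧ d γ ≤ n)
    (htr : ∀ γ, |(A γ).trace| ≤ 2) :
    LB d d2 ∨ ∀ a b : ℝ, 0 ≤ a → 0 < b → ∀ t : ℝ,
      Summable fun γ : G => Real.exp (-(a * d γ + b * d2 γ) - t * d γ) := by
  obtain ⟨p, hp1, hp2⟩ := H.exists_unip hfin (infinite_of_shell hfin hshell) htr
  obtain ⟨R, R', t0, h1, h2, h3, h4⟩ := unip_conj (A p) (H.det p) hp1 hp2
  refine (H.conj R R' h1 h2).para_diag H2 hfin hshell (fun γ => ?_) h3 (p := p) h4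
  have e : (conjHom A R R' h1 h2 γ).trace = (A γ).trace := by
    change (R' * A γ * R).trace = _
    rw [Matrix.trace_mul_cycle, h2, one_mul]
  rw [e]
  exact htr γ

end HRep

/-- The critical exponent `δ_PPS` of the Paulin–Pollicott–Schapira Poincaré series is
squeezed between the lower and upper exponential growth rates of the shell sums `G₁(n)`. -/
theorem pps_exponent_between_shell_growth_rates (G : Type*) [Group G]
    (ρ1 ρ2 : G →* SL(2, ℝ)) (o1 o2 : ℍ) (a b : ℝ) (ha : 0 ≤ a) (hb : 0 ≤ b)
    (hfin : ∀ r : ℝ, {γ : G | dOrb ρ1 o1 γ ≤ r}.Finite)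
    (hshell : ∀ᶠ n : ℕ in Filter.atTop,
      ∃ γ : G, (n : ℝ) - 1 < dOrb ρ1 o1 γ ∧ dOrb ρ1 o1 γ ≤ n)
    (hconv : ∃ t : ℝ, Summable fun γ : G =>
      Real.exp (-(a * dOrb ρ1 o1 γ + b * dOrb ρ2 o2 γ) - t * dOrb ρ1 o1 γ)) :
    Filter.liminf (fun n : ℕ =>
        Real.log (∑' γ : {γ : G // (n : ℝ) - 1 < dOrb ρ1 o1 γ ∧ dOrb ρ1 o1 γ ≤ n},
          Real.exp (-(a * dOrb ρ1 o1 (γ : G) + b * dOrb ρ2 o2 (γ : G)))) / n)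
        Filter.atTop
      ≤ sInf {t : ℝ | Summable fun γ : G =>
          Real.exp (-(a * dOrb ρ1 o1 γ + b * dOrb ρ2 o2 γ) - t * dOrb ρ1 o1 γ)} ∧
    sInf {t : ℝ | Summable fun γ : G =>
        Real.exp (-(a * dOrb ρ1 o1 γ + b * dOrb ρ2 o2 γ) - t * dOrb ρ1 o1 γ)}
      ≤ Filter.limsup (fun n : ℕ =>
          Real.log (∑' γ : {γ : G // (n : ℝ) - 1 < dOrb ρ1 o1 γ ∧ dOrb ρ1 o1 γ ≤ n},
            Real.exp (-(a * dOrb ρ1 o1 (γ : G) + b * dOrb ρ2 o2 (γ : G)))) / n)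
          Filter.atTop := by
  obtain ⟨A, P, P', H⟩ := HRep.ofOrb ρ1 o1
  obtain ⟨B, Q, Q', H2⟩ := HRep.ofOrb ρ2 o2
  refine analytic_main (dOrb ρ1 o1) (fun γ => a * dOrb ρ1 o1 γ + b * dOrb ρ2 o2 γ) H.nonneg hfin hshell hconv ?_
  have ofLB : LB (dOrb ρ1 o1) (dOrb ρ2 o2) → ∃ C : ℝ, ∀ᶠ n : ℕ in Filter.atTop,
      ∃ γ : G, ((n : ℝ) - 1 < dOrb ρ1 o1 γ ∧ dOrb ρ1 o1 γ ≤ n) ∧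
        a * dOrb ρ1 o1 γ + b * dOrb ρ2 o2 γ ≤ C * n := by
    rintro ⟨C, hC⟩
    refine ⟨a + b * C, ?_⟩
    filter_upwards [hC] with n ⟨γ, h1, h2⟩
    refine ⟨γ, h1, ?_⟩
    have h3 := mul_le_mul_of_nonneg_left h1.2 ha
    have h4 := mul_le_mul_of_nonneg_left h2 hb
    linarith
  rcases hb.eq_or_lt with hb0 | hb0
  · left
    refine ⟨a, ?_⟩
    filter_upwards [hshell] with n ⟨γ, h1⟩
    refine ⟨γ, h1, ?_⟩
    rw [← hb0, zero_mul, add_zero]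
    exact mul_le_mul_of_nonneg_left h1.2 ha
  · by_cases hhyp : ∃ α : G, 2 < |(A α).trace|
    · obtain ⟨α, hα⟩ := hhyp
      exact Or.inl (ofLB (H.hyp_case H2 hfin hshell hα))
    · push Not at hhyp
      rcases H.para_case H2 hfin hshell hhyp with h | h
      · exact Or.inl (ofLB h)
      · exact Or.inr (h a b ha hb0)
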